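/- arXiv:2201.08521 — 2 statements merged into one kernel-verified Lean document; each statement's English description precedes it below -/
import Mathlib

section
/- In PG(n,q), with n ≥ 4, let K be a plane blocking set of type (a,b,c)_{n-1} with a = θ_{n-3}, b = θ_{n-2} + q^{n−3} and c = θ_{n-2} + q^{n−2}. Then k = θ_{n-1} + q^{n−2}, t_a = (q²−q)/2, t_b = θ_n − θ_2 and t_c = (q²+3q+2)/2. -/
open Module Set

noncomputable section

variable (F : Type) [Field F]

/-- The point set of `PG(n,q)`: the projectivization of `GF(q)^{n+1}`. -/
abbrev PGPoint (n : ℕ) := Projectivization F (Fin (n + 1) → F)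

/-- The set of points of the projective space lying in (the projectivization of)
a linear subspace `W`. A `d`-dimensional projective subspace corresponds to a
submodule `W` with `finrank F W = d + 1`; hyperplanes correspond to `finrank F W = n`. -/
def projSet (n : ℕ) (W : Submodule F (Fin (n + 1) → F)) : Set (PGPoint F n) :=
  {x | x.submodule ≤ W}

/-- `θ_m = (q^{m+1} - 1)/(q - 1)`, the number of points of `PG(m,q)`. -/
def theta (q m : ℕ) : ℕ := (q ^ (m + 1) - 1) / (q - 1)

/-- `K` is of type `(a,b,c)_{n-1}`: every hyperplane meets `K` in `a`, `b` or `c`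
points, and each of the three values is attained by some hyperplane. -/
def IsType3 (n : ℕ) (K : Set (PGPoint F n)) (a b c : ℕ) : Prop :=
  (∀ W : Submodule F (Fin (n + 1) → F), finrank F W = n →
      (K ∩ projSet F n W).ncard = a ∨ (K ∩ projSet F n W).ncard = b ∨
        (K ∩ projSet F n W).ncard = c) ∧
  (∃ W : Submodule F (Fin (n + 1) → F), finrank F W = n ∧ (K ∩ projSet F n W).ncard = a) ∧
  (∃ W : Submodule F (Fin (n + 1) → F), finrank F W = n ∧ (K ∩ projSet F n W).ncard = b) ∧
  (∃ W : Submodule F (Fin (n + 1) → F), finrank F W = n ∧ (K ∩ projSet F n W).ncard = c)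

/-- `tnum K m`: the number of hyperplanes meeting `K` in exactly `m` points. -/
def tnum (n : ℕ) (K : Set (PGPoint F n)) (m : ℕ) : ℕ :=
  {W : Submodule F (Fin (n + 1) → F) | finrank F W = n ∧ (K ∩ projSet F n W).ncard = m}.ncard

/-- `K` blocks every `t`-dimensional projective subspace of `PG(n,q)`,
i.e. `K` is an `(n-t)`-blocking set. -/
def BlocksDim (n t : ℕ) (K : Set (PGPoint F n)) : Prop :=
  ∀ W : Submodule F (Fin (n + 1) → F), finrank F W = t + 1 → (K ∩ projSet F n W).Nonempty


section Counting

variable {F}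
variable {V : Type} [AddCommGroup V] [Module F V]

theorem ncard_eq_mul_of_fibers {α β : Type*} [Finite α] {s : Set α} {t : Set β} {m : ℕ}
    (ht : t.Finite) (f : α → β) (hf : ∀ a ∈ s, f a ∈ t)
    (hm : ∀ b ∈ t, {a | a ∈ s ∧ f a = b}.ncard = m) : s.ncard = t.ncard * m := by
  classical
  have := Fintype.ofFinite α
  rw [Set.ncard_eq_toFinset_card', Set.ncard_eq_toFinset_card t ht,
    Finset.card_eq_sum_card_fiberwise (f := f) (t := ht.toFinset)
      (fun a ha => by simpa using hf a (by simpa using ha)), ← smul_eq_mul, ← Finset.sum_const]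
  refine Finset.sum_congr rfl fun b hb => ?_
  rw [← hm b (by simpa using hb), Set.ncard_eq_toFinset_card']
  congr 1
  ext a
  simp

theorem ncard_coe_submodule [Finite V] (W : Submodule F V) :
    (W : Set V).ncard = Nat.card F ^ finrank F W := by
  rw [← Module.natCard_eq_pow_finrank (K := F) (V := W)]
  rfl

theorem ncard_nonzero_add_one [Finite V] (W : Submodule F V) :
    {v | v ∈ W ∧ v ≠ 0}.ncard + 1 = Nat.card F ^ finrank F W := by
  rw [← ncard_coe_submodule,
    ← Set.ncard_sdiff_singleton_add_one (s := (W : Set V)) (a := 0) W.zero_mem]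
  rfl

/-- The hyperplanes containing a given subspace. -/
def hyperplanesThrough [Finite V] (S : Submodule F V) : Finset (Submodule F V) :=
  (Set.toFinite {W : Submodule F V | finrank F W + 1 = finrank F V ∧ S ≤ W}).toFinset

theorem mem_hyperplanesThrough [Finite V] {S W : Submodule F V} :
    W ∈ hyperplanesThrough S ↔ finrank F W + 1 = finrank F V ∧ S ≤ W := by
  simp [hyperplanesThrough]

theorem card_hyperplanesThrough [Finite F] [Finite V] (S : Submodule F V) :
    (hyperplanesThrough S).card * (Nat.card F - 1) + 1
      = Nat.card F ^ (finrank F V - finrank F S) := by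
  have : Finite (Dual F V) := Module.finite_of_finite F
  have hS := Subspace.finrank_add_finrank_dualAnnihilator_eq S
  rw [show finrank F V - finrank F S = finrank F S.dualAnnihilator by omega,
    ← ncard_nonzero_add_one]
  congr 1
  rw [← Set.ncard_coe_finset]
  refine (ncard_eq_mul_of_fibers (Finset.finite_toSet _) LinearMap.ker ?_ ?_).symm
  · rintro f ⟨hf, hf0⟩
    rw [Finset.mem_coe, mem_hyperplanesThrough]
    refine ⟨Module.Dual.finrank_ker_add_one_of_ne_zero hf0, fun v hv => ?_⟩
    exact (Submodule.mem_dualAnnihilator f).1 hf v hv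
  · intro W hW
    rw [Finset.mem_coe, mem_hyperplanesThrough] at hW
    have hW' := Subspace.finrank_add_finrank_dualAnnihilator_eq W
    have h1 := ncard_nonzero_add_one W.dualAnnihilator
    rw [show finrank F W.dualAnnihilator = 1 by omega, pow_one] at h1
    rw [← h1, Nat.add_sub_cancel]
    congr 1
    ext f
    constructor
    · rintro ⟨⟨_, hf0⟩, rfl⟩
      exact ⟨(Submodule.mem_dualAnnihilator f).2 fun v hv => hv, hf0⟩
    · rintro ⟨hf, hf0⟩
      have hle : W ≤ LinearMap.ker f := fun v hv => (Submodule.mem_dualAnnihilator f).1 hf v hv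
      have := Module.Dual.finrank_ker_add_one_of_ne_zero hf0
      have heq : W = LinearMap.ker f := Submodule.eq_of_le_of_finrank_eq hle (by omega)
      refine ⟨⟨(Submodule.mem_dualAnnihilator f).2 fun v hv => hle (hW.2 hv), hf0⟩, heq.symm⟩

theorem card_hyperplanesThrough_of_codim_one [Finite F] [Finite V] {S : Submodule F V}
    (h : finrank F V - finrank F S = 1) : (hyperplanesThrough S).card = 1 := by
  have h1 := card_hyperplanesThrough S
  have hq : 1 < Nat.card F := Finite.one_lt_card
  obtain ⟨p, hp⟩ := Nat.exists_eq_add_of_lt hq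
  rw [h, hp] at h1
  simp only [show 1 + p + 1 - 1 = p + 1 by omega] at h1
  have : ((hyperplanesThrough S).card) * (p + 1) = 1 * (p + 1) := by linarith
  exact Nat.eq_of_mul_eq_mul_right (by omega) this

theorem card_hyperplanesThrough_of_codim_two [Finite F] [Finite V] {S : Submodule F V}
    (h : finrank F V - finrank F S = 2) : (hyperplanesThrough S).card = Nat.card F + 1 := by
  have h1 := card_hyperplanesThrough S
  have hq : 1 < Nat.card F := Finite.one_lt_card
  obtain ⟨p, hp⟩ := Nat.exists_eq_add_of_lt hq
  rw [h, hp] at h1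
  rw [hp]
  simp only [show 1 + p + 1 - 1 = p + 1 by omega] at h1
  have : ((hyperplanesThrough S).card) * (p + 1) = (1 + p + 1 + 1) * (p + 1) := by nlinarith
  exact Nat.eq_of_mul_eq_mul_right (by omega) this

theorem card_hyperplanesThrough_of_codim_three [Finite F] [Finite V] {S : Submodule F V}
    (h : finrank F V - finrank F S = 3) :
    (hyperplanesThrough S).card = Nat.card F ^ 2 + Nat.card F + 1 := by
  have h1 := card_hyperplanesThrough S
  have hq : 1 < Nat.card F := Finite.one_lt_card
  obtain ⟨p, hp⟩ := Nat.exists_eq_add_of_lt hq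
  rw [h, hp] at h1
  rw [hp]
  simp only [show 1 + p + 1 - 1 = p + 1 by omega] at h1
  have : ((hyperplanesThrough S).card) * (p + 1)
      = ((1 + p + 1) ^ 2 + (1 + p + 1) + 1) * (p + 1) := by nlinarith
  exact Nat.eq_of_mul_eq_mul_right (by omega) this

theorem finrank_sup_span_singleton_of_notMem [Finite V] {S : Submodule F V} {v : V}
    (hv : v ∉ S) : finrank F ↥(S ⊔ F ∙ v) = finrank F S + 1 := by
  have h := Submodule.finrank_sup_add_finrank_inf_eq S (F ∙ v)
  have hv0 : v ≠ 0 := fun h0 => hv (h0 ▸ S.zero_mem)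
  have hinf : S ⊓ (F ∙ v) = ⊥ := by
    rw [← disjoint_iff, Submodule.disjoint_span_singleton' hv0]
    exact hv
  rw [hinf, finrank_bot, finrank_span_singleton hv0] at h
  omega

theorem sum_ncard_inter_hyperplanesThrough [Finite V] (S : Submodule F V) (C : Set V) {r : ℕ}
    (hr : ∀ v, v ∉ S → (hyperplanesThrough (S ⊔ F ∙ v)).card = r) :
    ∑ W ∈ hyperplanesThrough S, (C ∩ W).ncard + (C ∩ S).ncard * r
      = (hyperplanesThrough S).card * (C ∩ S).ncard + C.ncard * r := by
  classical
  have := Fintype.ofFinite V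
  have hC : C.ncard = (C ∩ S).ncard + (C \ S).ncard :=
    (Set.ncard_inter_add_ncard_sdiff_eq_ncard C S).symm
  have hW : ∀ W ∈ hyperplanesThrough S,
      (C ∩ W).ncard = (C ∩ S).ncard + ((C \ S) ∩ W : Set V).ncard := by
    intro W hW
    rw [← Set.ncard_inter_add_ncard_sdiff_eq_ncard (C ∩ W) S]
    have := (mem_hyperplanesThrough.1 hW).2
    congr 2
    · ext v
      constructor
      · rintro ⟨⟨h1, _⟩, h2⟩
        exact ⟨h1, h2⟩
      · rintro ⟨h1, h2⟩
        exact ⟨⟨h1, this h2⟩, h2⟩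
    · ext v
      constructor
      · rintro ⟨⟨h1, h2⟩, h3⟩
        exact ⟨⟨h1, h3⟩, h2⟩
      · rintro ⟨⟨h1, h3⟩, h2⟩
        exact ⟨⟨h1, h2⟩, h3⟩
  have key : ∑ W ∈ hyperplanesThrough S, ((C \ S) ∩ W : Set V).ncard = (C \ S).ncard * r := by
    have h := Finset.sum_card_bipartiteAbove_eq_sum_card_bipartiteBelow
      (fun (W : Submodule F V) (v : V) => v ∈ W) (s := hyperplanesThrough S)
      (t := (C \ (S : Set V)).toFinset)
    rw [Set.ncard_eq_toFinset_card', ← smul_eq_mul, ← Finset.sum_const]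
    refine Eq.trans (Finset.sum_congr rfl fun W _ => ?_)
      (h.trans (Finset.sum_congr rfl fun v hv => ?_))
    · rw [Set.ncard_eq_toFinset_card']
      congr 1
      ext v
      simp [Finset.mem_bipartiteAbove]
    · have hv' : v ∉ S := by
        have := (Set.mem_toFinset.1 hv).2
        exact this
      rw [← hr v hv']
      congr 1
      ext W
      simp [Finset.mem_bipartiteBelow, mem_hyperplanesThrough, and_assoc]
  rw [Finset.sum_congr rfl hW, Finset.sum_add_distrib, key, Finset.sum_const, smul_eq_mul, hC]
  ring

theorem sum_ncard_inter_pencil [Finite F] [Finite V] {U : Submodule F V}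
    (hU : finrank F U + 2 = finrank F V) (C : Set V) :
    ∑ W ∈ hyperplanesThrough U, (C ∩ W).ncard = C.ncard + Nat.card F * (C ∩ U).ncard := by
  have h := sum_ncard_inter_hyperplanesThrough U C (r := 1) fun v hv =>
    card_hyperplanesThrough_of_codim_one (by
      rw [finrank_sup_span_singleton_of_notMem hv]; omega)
  rw [card_hyperplanesThrough_of_codim_two (by omega)] at h
  linarith

theorem sum_eq_of_three_values {ι : Type*} [DecidableEq ι] (s : Finset ι) (f : ι → ℕ) {a b c : ℕ}
    (hab : a ≠ b) (hac : a ≠ c) (hbc : b ≠ c) (h : ∀ i ∈ s, f i = a ∨ f i = b ∨ f i = c) :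
    s.card = (s.filter (f · = a)).card + (s.filter (f · = b)).card + (s.filter (f · = c)).card ∧
    ∑ i ∈ s, f i = (s.filter (f · = a)).card * a + (s.filter (f · = b)).card * b
      + (s.filter (f · = c)).card * c := by
  simp only [Finset.card_eq_sum_ones, Finset.sum_filter, Finset.sum_mul,
    ← Finset.sum_add_distrib]
  constructor <;> refine Finset.sum_congr rfl fun i hi => ?_ <;>
    rcases h i hi with h | h | h <;> simp [h, hab, hac, hbc, hab.symm, hac.symm, hbc.symm]


theorem finrank_inf_add_two [Finite V] {W H : Submodule F V} (hW : finrank F W + 1 = finrank F V)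
    (hH : finrank F H + 1 = finrank F V) (hne : W ≠ H) :
    finrank F ↥(W ⊓ H) + 2 = finrank F V := by
  have h := Submodule.finrank_sup_add_finrank_inf_eq W H
  have hlt : H < W ⊔ H := by
    refine lt_of_le_of_ne le_sup_right fun heq => hne ?_
    exact Submodule.eq_of_le_of_finrank_eq (heq ▸ le_sup_left) (by omega)
  have h1 := Submodule.finrank_lt_finrank_of_lt hlt
  have h2 := Submodule.finrank_le (W ⊔ H)
  omega

theorem exists_le_finrank_eq [Finite V] {A : Submodule F V} {d : ℕ} (h : d ≤ finrank F A) :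
    ∃ W ≤ A, finrank F W = d := by
  obtain ⟨f, hf⟩ := exists_linearIndependent_of_le_finrank h
  refine ⟨(Submodule.span F (Set.range f)).map A.subtype, Submodule.map_subtype_le _ _, ?_⟩
  rw [Submodule.finrank_map_subtype_eq, finrank_span_eq_card hf, Fintype.card_fin]

/-- The equality case of the Bose–Burton theorem for sets blocking the planes of a subspace `H`:
a blocking set of the smallest possible size is a subspace of codimension two. -/
theorem exists_submodule_eq_of_blocking [Finite F] [Finite V] {C : Set V} {H : Submodule F V}
    {d : ℕ} (h_zero : (0 : V) ∈ C) (h_smul : ∀ (t : F), ∀ v ∈ C, t • v ∈ C)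
    (h_block : ∀ W : Submodule F V, finrank F W = 3 → ∃ v ∈ W, v ∈ C ∧ v ≠ 0)
    (hH : finrank F H = d + 2) (h_card : (C ∩ H).ncard = Nat.card F ^ d) :
    ∃ S ≤ H, (S : Set V) = C ∩ H ∧ finrank F S = d := by
  have hq : 1 < Nat.card F := Finite.one_lt_card
  have h_add : ∀ u v, u ∈ C ∩ H → v ∈ C ∩ H → u + v ∈ C ∩ H := by
    rintro u v ⟨hu, huH⟩ ⟨hv, hvH⟩
    refine ⟨?_, H.add_mem huH hvH⟩
    by_contra hp
    let P : Submodule F V → Prop := fun A => A ≤ H ∧ u + v ∈ A ∧ ∀ x ∈ A, x ∈ C → x = 0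
    have hP : P (F ∙ (u + v)) := by
      refine ⟨?_, Submodule.mem_span_singleton_self _, ?_⟩
      · rw [Submodule.span_singleton_le_iff_mem]
        exact H.add_mem huH hvH
      · intro x hx hxC
        obtain ⟨t, rfl⟩ := Submodule.mem_span_singleton.1 hx
        by_contra h0
        have ht : t ≠ 0 := fun h => h0 (by rw [h, zero_smul])
        exact hp (by simpa [smul_smul, ht] using h_smul t⁻¹ _ hxC)
    obtain ⟨A, -, hA⟩ := (Set.toFinite {A | P A}).exists_le_maximal hP
    obtain ⟨hAH, hpA, hAC⟩ := hA.prop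
    have hA2 : finrank F A ≤ 2 := by
      by_contra! h3
      obtain ⟨W, hWA, hW⟩ := exists_le_finrank_eq (A := A) (d := 3) h3
      obtain ⟨x, hxW, hxC, hx0⟩ := h_block W hW
      exact hx0 (hAC x (hWA hxW) hxC)
    have h_surj : ∀ h ∈ H, ∃ c ∈ C ∩ H, ∃ a ∈ A, c + a = h := by
      intro h hh
      by_cases hhA : h ∈ A
      · exact ⟨0, ⟨h_zero, H.zero_mem⟩, h, hhA, zero_add h⟩
      have hnP : ¬ P (A ⊔ F ∙ h) := fun hP' =>
        hhA (hA.le_of_ge hP' le_sup_left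
          (Submodule.mem_sup_right (Submodule.mem_span_singleton_self h)))
      have : ∃ x ∈ A ⊔ F ∙ h, x ∈ C ∧ x ≠ 0 := by
        by_contra! hx
        exact hnP ⟨sup_le hAH ((Submodule.span_singleton_le_iff_mem _ _).2 hh),
          Submodule.mem_sup_left hpA, hx⟩
      obtain ⟨x, hx, hxC, hx0⟩ := this
      obtain ⟨a, ha, y, hy, rfl⟩ := Submodule.mem_sup.1 hx
      obtain ⟨t, rfl⟩ := Submodule.mem_span_singleton.1 hy
      have ht : t ≠ 0 := by
        rintro rfl
        rw [zero_smul, add_zero] at hxC hx0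
        exact hx0 (hAC a ha hxC)
      refine ⟨t⁻¹ • (a + t • h), ⟨h_smul _ _ hxC, ?_⟩, -(t⁻¹ • a),
        A.neg_mem (A.smul_mem _ ha), ?_⟩
      · exact H.smul_mem _ (H.add_mem (hAH ha) (H.smul_mem _ hh))
      · rw [smul_add, smul_smul, inv_mul_cancel₀ ht, one_smul]
        abel
    let φ : ↥(C ∩ (H : Set V)) × A → H := fun x => ⟨x.1 + x.2, H.add_mem x.1.2.2 (hAH x.2.2)⟩
    have hφ : Function.Surjective φ := by
      rintro ⟨h, hh⟩
      obtain ⟨c, hc, a, ha, rfl⟩ := h_surj h hh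
      exact ⟨(⟨c, hc⟩, ⟨a, ha⟩), rfl⟩
    have h_inj : Function.Injective φ := by
      refine (hφ.bijective_of_nat_card_le ?_).1
      rw [Nat.card_prod, Nat.card_coe_set_eq, h_card, Module.natCard_eq_pow_finrank (K := F) (V := A),
        Module.natCard_eq_pow_finrank (K := F) (V := H), ← pow_add]
      exact Nat.pow_le_pow_right hq.le (by omega)
    have hv' : -v ∈ C ∩ (H : Set V) :=
      ⟨by simpa using h_smul (-1) v hv, H.neg_mem hvH⟩
    have h_eq : φ (⟨u, hu, huH⟩, 0) = φ (⟨-v, hv'⟩, ⟨u + v, hpA⟩) := by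
      apply Subtype.ext
      change u + 0 = -v + (u + v)
      abel
    have := congrArg (fun x => (x.2 : V)) (h_inj h_eq)
    exact hp (by rw [← show (0 : V) = u + v from this]; exact h_zero)
  let S : Submodule F V :=
    { carrier := C ∩ H
      add_mem' := fun {u v} hu hv => h_add u v hu hv
      zero_mem' := ⟨h_zero, H.zero_mem⟩
      smul_mem' := fun t v hv => ⟨h_smul t v hv.1, H.smul_mem t hv.2⟩ }
  refine ⟨S, fun v hv => hv.2, rfl, ?_⟩
  have hS := ncard_coe_submodule S
  rw [show (S : Set V) = C ∩ H from rfl, h_card] at hS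
  exact (Nat.pow_right_injective hq hS).symm

/-- The numbers `x`, `y` of hyperplanes with `b` and `c` points in a pencil whose axis contains the
base of a hyperplane with `a` points, and the numbers `x'`, `y'` for an axis in the same hyperplane
that does not contain the base. -/
theorem pencil_arithmetic {q Q T α β γ x y z x' y' z' : ℕ} (hq : 2 ≤ q) (hQ : 0 < Q)
    (hα : α = Q * q) (hβ : β + Q = Q * q ^ 2 + Q * q) (hγ : γ + Q * q = 2 * Q * q ^ 2)
    (hz : 1 ≤ z) (hz' : 1 ≤ z') (hs : z + x + y = q + 1) (hs' : z' + x' + y' = q + 1)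
    (hT : z * α + x * β + y * γ = T + q * (Q * q))
    (hT' : z' * α + x' * β + y' * γ = T + q * Q) :
    (T + Q * q = Q * q ^ 3 + Q * q ^ 2 ∧ x = 0 ∧ 2 * y = q + 2 ∧ x' = q ∧ y' = 0) ∨
    (T = Q * q ^ 3 ∧ x = q ∧ y = 0 ∧ x' = 0 ∧ 2 * y' = q) := by
  zify at *
  have hβ' : (β : ℤ) = Q * q ^ 2 + Q * q - Q := by linarith
  have hγ' : (γ : ℤ) = 2 * Q * q ^ 2 - Q * q := by linarith
  have hzz : (z : ℤ) = q + 1 - x - y := by linarith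
  have hzz' : (z' : ℤ) = q + 1 - x' - y' := by linarith
  rw [hα, hβ', hγ', hzz] at hT
  rw [hα, hβ', hγ', hzz'] at hT'
  have hT1 : (T : ℤ) = Q * (q + (q - 1) * (x * (q + 1) + 2 * q * y)) := by linarith
  have hT2 : (T : ℤ) = Q * (q + (q - 1) * (x' * (q + 1) + 2 * q * y' + q)) := by
    linarith
  have h1 : (x : ℤ) * (q + 1) + 2 * q * y = x' * (q + 1) + 2 * q * y' + q := by
    have h2 := hT1.symm.trans hT2
    have h3 := mul_left_cancel₀ (by positivity) h2
    have h4 := add_left_cancel h3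
    exact mul_left_cancel₀ (by linarith) h4
  have hdvd : (q : ℤ) ∣ x - x' := ⟨1 + 2 * y' - 2 * y - (x - x'), by linarith⟩
  obtain ⟨e, he⟩ := hdvd
  have he1 : e ≤ 1 := by nlinarith
  have he2 : -1 ≤ e := by nlinarith
  have hx : (x : ℤ) = x' + q * e := by linarith
  have h5 : e * (q + 1) + 2 * (y - y') = (1 : ℤ) := by
    rw [hx] at h1
    refine mul_left_cancel₀ (a := (q : ℤ)) (by positivity) ?_
    linarith
  have : e = -1 ∨ e = 0 ∨ e = 1 := by omega
  rcases this with rfl | rfl | rfl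
  · left
    have hx0 : (x : ℤ) = 0 := by linarith
    have hy2 : 2 * (y : ℤ) = q + 2 := by linarith
    refine ⟨?_, hx0, hy2, by linarith, by linarith⟩
    rw [hT1, hx0, show (2 : ℤ) * q * y = q * (2 * y) by ring, hy2]
    ring
  · omega
  · right
    have hx0 : (x : ℤ) = q := by linarith
    have hy2 : (y : ℤ) = 0 := by linarith
    refine ⟨?_, hx0, hy2, by linarith, by linarith⟩
    rw [hT1, hx0, hy2]
    ring

/-- The cone of vectors over a plane blocking set with three hyperplane intersection numbers, in a
space of vector dimension `m + 4`; the intersection numbers `α`, `β`, `γ` count vectors. -/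
structure IsBlockingCone (C : Set V) (m α β γ : ℕ) : Prop where
  zero_mem : (0 : V) ∈ C
  smul_mem : ∀ (t : F), ∀ v ∈ C, t • v ∈ C
  block : ∀ W : Submodule F V, finrank F W = 3 → ∃ v ∈ W, v ∈ C ∧ v ≠ 0
  finrank_eq : finrank F V = m + 4
  type : ∀ W : Submodule F V, finrank F W + 1 = finrank F V →
    (C ∩ W).ncard = α ∨ (C ∩ W).ncard = β ∨ (C ∩ W).ncard = γ
  α_eq : α = Nat.card F ^ m * Nat.card F
  β_eq : β + Nat.card F ^ m = Nat.card F ^ m * Nat.card F ^ 2 + Nat.card F ^ m * Nat.card F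
  γ_eq : γ + Nat.card F ^ m * Nat.card F = 2 * Nat.card F ^ m * Nat.card F ^ 2

open Classical in
/-- The hyperplanes through `U` meeting `C` in exactly `t` vectors. -/
def hyperplanesMeeting [Finite V] (C : Set V) (U : Submodule F V) (t : ℕ) :
    Finset (Submodule F V) :=
  (hyperplanesThrough U).filter fun W => (C ∩ W).ncard = t

theorem mem_hyperplanesMeeting [Finite V] {C : Set V} {U W : Submodule F V} {t : ℕ} :
    W ∈ hyperplanesMeeting C U t ↔
      (finrank F W + 1 = finrank F V ∧ U ≤ W) ∧ (C ∩ W).ncard = t := by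
  simp [hyperplanesMeeting, mem_hyperplanesThrough]

namespace IsBlockingCone

variable {C : Set V} {m α β γ : ℕ}

theorem α_ne_β [Finite F] (hC : IsBlockingCone (F := F) C m α β γ) : α ≠ β := by
  have h1 := hC.α_eq
  have h2 := hC.β_eq
  have hq : 1 < Nat.card F := Finite.one_lt_card
  have hQ : 0 < Nat.card F ^ m := by positivity
  generalize Nat.card F ^ m = Q at *
  intro h
  nlinarith [Nat.mul_lt_mul_of_pos_left (show 1 < Nat.card F ^ 2 by nlinarith) hQ]

theorem α_ne_γ [Finite F] (hC : IsBlockingCone (F := F) C m α β γ) : α ≠ γ := by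
  have h1 := hC.α_eq
  have h2 := hC.γ_eq
  have hq : 1 < Nat.card F := Finite.one_lt_card
  have hQ : 0 < Nat.card F ^ m := by positivity
  generalize Nat.card F ^ m = Q at *
  intro h
  nlinarith [Nat.mul_lt_mul_of_pos_left (show Nat.card F < Nat.card F ^ 2 by nlinarith) hQ]

theorem β_ne_γ [Finite F] (hC : IsBlockingCone (F := F) C m α β γ) : β ≠ γ := by
  have h1 := hC.β_eq
  have h2 := hC.γ_eq
  have hq : 1 < Nat.card F := Finite.one_lt_card
  have hQ : 0 < Nat.card F ^ m := by positivity
  generalize Nat.card F ^ m = Q at *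
  intro h
  have : (Q : ℤ) * ((Nat.card F : ℤ) - 1) ^ 2 = 0 := by
    zify at *
    linarith
  have h3 : (0 : ℤ) < Q * ((Nat.card F : ℤ) - 1) ^ 2 := by
    have : (0 : ℤ) < (Nat.card F : ℤ) - 1 := by omega
    positivity
  omega

theorem counts [Finite F] [Finite V] (hC : IsBlockingCone (F := F) C m α β γ) (U : Submodule F V) :
    (hyperplanesThrough U).card = (hyperplanesMeeting C U α).card +
      (hyperplanesMeeting C U β).card + (hyperplanesMeeting C U γ).card ∧
    ∑ W ∈ hyperplanesThrough U, (C ∩ W).ncard = (hyperplanesMeeting C U α).card * α +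
      (hyperplanesMeeting C U β).card * β + (hyperplanesMeeting C U γ).card * γ := by
  classical
  simpa [hyperplanesMeeting] using sum_eq_of_three_values (hyperplanesThrough U)
    (fun W => (C ∩ (W : Set V)).ncard) hC.α_ne_β hC.α_ne_γ hC.β_ne_γ
    fun W hW => hC.type W (mem_hyperplanesThrough.1 hW).1

theorem exists_base [Finite F] [Finite V] (hC : IsBlockingCone (F := F) C m α β γ)
    {H : Submodule F V} (hH : finrank F H + 1 = finrank F V) (hα : (C ∩ H).ncard = α) :
    ∃ S ≤ H, (S : Set V) = C ∩ H ∧ finrank F S = m + 1 :=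
  exists_submodule_eq_of_blocking hC.zero_mem hC.smul_mem hC.block
    (by have := hC.finrank_eq; omega) (by rw [hα, hC.α_eq, pow_succ])

theorem ncard_inter_of_base_le [Finite V] {U H S : Submodule F V}
    (hSH : (S : Set V) = C ∩ H) (hU : U ≤ H) (hS : finrank F S = m + 1) (hSU : S ≤ U) :
    (C ∩ U).ncard = Nat.card F ^ m * Nat.card F := by
  have : C ∩ (U : Set V) = S := by
    ext v
    constructor
    · rintro ⟨h1, h2⟩
      rw [hSH]
      exact ⟨h1, hU h2⟩
    · intro hv
      refine ⟨?_, hSU hv⟩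
      rw [hSH] at hv
      exact hv.1
  rw [this, ncard_coe_submodule, hS, pow_succ]

theorem ncard_inter_of_not_base_le [Finite V] (hC : IsBlockingCone (F := F) C m α β γ)
    {U H S : Submodule F V} (hH : finrank F H + 1 = finrank F V)
    (hSH : (S : Set V) = C ∩ H) (hU : U ≤ H) (hU2 : finrank F U + 2 = finrank F V)
    (hS : finrank F S = m + 1) (hSU : ¬ S ≤ U) :
    (C ∩ U).ncard = Nat.card F ^ m := by
  have h1 : C ∩ (U : Set V) = ↑(S ⊓ U) := by
    ext v
    rw [Submodule.coe_inf, hSH]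
    constructor
    · rintro ⟨h1, h2⟩
      exact ⟨⟨h1, hU h2⟩, h2⟩
    · rintro ⟨⟨h1, _⟩, h2⟩
      exact ⟨h1, h2⟩
  have hSH' : S ≤ H := fun v hv => (hSH ▸ hv : v ∈ C ∩ (H : Set V)).2
  have h2 := Submodule.finrank_sup_add_finrank_inf_eq S U
  have h3 := Submodule.finrank_lt_finrank_of_lt
    (lt_of_le_of_ne (le_sup_right : U ≤ S ⊔ U) fun h => hSU (h ▸ le_sup_left))
  have h4 := Submodule.finrank_mono (sup_le hSH' hU)
  have h5 := hC.finrank_eq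
  rw [h1, ncard_coe_submodule, show finrank F ↥(S ⊓ U) = m by omega]

theorem pencil_dichotomy [Finite F] [Finite V] (hC : IsBlockingCone (F := F) C m α β γ)
    {H S U U' : Submodule F V} (hH : finrank F H + 1 = finrank F V) (hα : (C ∩ H).ncard = α)
    (hSH : (S : Set V) = C ∩ H) (hS : finrank F S = m + 1)
    (hU : U ≤ H) (hU2 : finrank F U + 2 = finrank F V) (hSU : S ≤ U)
    (hU' : U' ≤ H) (hU2' : finrank F U' + 2 = finrank F V) (hSU' : ¬ S ≤ U') :
    (C.ncard + Nat.card F ^ m * Nat.card F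
        = Nat.card F ^ m * Nat.card F ^ 3 + Nat.card F ^ m * Nat.card F ^ 2 ∧
      (hyperplanesMeeting C U β).card = 0 ∧
      2 * (hyperplanesMeeting C U γ).card = Nat.card F + 2 ∧
      (hyperplanesMeeting C U' β).card = Nat.card F ∧ (hyperplanesMeeting C U' γ).card = 0) ∨
    (C.ncard = Nat.card F ^ m * Nat.card F ^ 3 ∧
      (hyperplanesMeeting C U β).card = Nat.card F ∧ (hyperplanesMeeting C U γ).card = 0 ∧
      (hyperplanesMeeting C U' β).card = 0 ∧
      2 * (hyperplanesMeeting C U' γ).card = Nat.card F) := by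
  have hq : 1 < Nat.card F := Finite.one_lt_card
  have h1 := hC.counts U
  have h2 := hC.counts U'
  rw [card_hyperplanesThrough_of_codim_two (by omega), sum_ncard_inter_pencil (by omega)] at h1 h2
  rw [ncard_inter_of_base_le hSH hU hS hSU] at h1
  rw [hC.ncard_inter_of_not_base_le hH hSH hU' hU2' hS hSU'] at h2
  exact pencil_arithmetic hq (by positivity) hC.α_eq hC.β_eq hC.γ_eq
    (Finset.card_pos.2 ⟨H, mem_hyperplanesMeeting.2 ⟨⟨hH, hU⟩, hα⟩⟩)
    (Finset.card_pos.2 ⟨H, mem_hyperplanesMeeting.2 ⟨⟨hH, hU'⟩, hα⟩⟩)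
    h1.1.symm h2.1.symm h1.2.symm h2.2.symm

theorem exists_axis_through_base [Finite V] (hC : IsBlockingCone (F := F) C m α β γ)
    {H S : Submodule F V} (hH : finrank F H + 1 = finrank F V) (hSH : S ≤ H) (hS : finrank F S = m + 1) :
    ∃ U ≤ H, finrank F U + 2 = finrank F V ∧ S ≤ U := by
  have hd := hC.finrank_eq
  have : S < H := lt_of_le_of_ne hSH (by rintro rfl; omega)
  obtain ⟨v, hvH, hvS⟩ := SetLike.exists_of_lt this
  refine ⟨S ⊔ F ∙ v, sup_le hSH ((Submodule.span_singleton_le_iff_mem _ _).2 hvH), ?_,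
    le_sup_left⟩
  rw [finrank_sup_span_singleton_of_notMem hvS]
  omega

theorem exists_axis_not_through_base [Finite V] {H S : Submodule F V}
    (hH : finrank F H + 1 = finrank F V) (hSH : S ≤ H) (hS : finrank F S = m + 1) :
    ∃ U ≤ H, finrank F U + 2 = finrank F V ∧ ¬ S ≤ U := by
  have hS0 : S ≠ ⊥ := by
    rintro rfl
    simp at hS
  obtain ⟨s, hs, hs0⟩ := Submodule.exists_mem_ne_zero_of_ne_bot hS0
  obtain ⟨f, hf⟩ : ∃ f : Dual F V, f s ≠ 0 := by
    by_contra! h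
    exact hs0 ((Module.forall_dual_apply_eq_zero_iff F s).1 h)
  have hf0 : f ≠ 0 := by
    rintro rfl
    exact hf rfl
  refine ⟨LinearMap.ker f ⊓ H, inf_le_right, ?_, fun h => hf (h hs).1⟩
  refine finrank_inf_add_two (Module.Dual.finrank_ker_add_one_of_ne_zero hf0) hH ?_
  rintro rfl
  exact hf (hSH hs)

/-- In the numerical case excluded by `not_exceptional`, the pencils whose axis lies in a hyperplane
meeting `C` in `α` vectors have a distribution depending only on whether the axis contains the base. -/
theorem exceptional_pencils [Finite F] [Finite V] (hC : IsBlockingCone (F := F) C m α β γ)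
    (hT : C.ncard = Nat.card F ^ m * Nat.card F ^ 3)
    {H S U : Submodule F V} (hH : finrank F H + 1 = finrank F V) (hα : (C ∩ H).ncard = α)
    (hSH : (S : Set V) = C ∩ H) (hS : finrank F S = m + 1)
    (hU : U ≤ H) (hU2 : finrank F U + 2 = finrank F V) :
    (S ≤ U → (hyperplanesMeeting C U β).card = Nat.card F ∧
      (hyperplanesMeeting C U γ).card = 0) ∧
    (¬ S ≤ U → (hyperplanesMeeting C U β).card = 0 ∧
      2 * (hyperplanesMeeting C U γ).card = Nat.card F) := by
  have hq : 1 < Nat.card F := Finite.one_lt_card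
  have hne : ¬ C.ncard + Nat.card F ^ m * Nat.card F
      = Nat.card F ^ m * Nat.card F ^ 3 + Nat.card F ^ m * Nat.card F ^ 2 := by
    rw [hT, Nat.add_left_cancel_iff]
    have hQ : 0 < Nat.card F ^ m := by positivity
    exact (Nat.mul_lt_mul_of_pos_left (show Nat.card F < Nat.card F ^ 2 by nlinarith) hQ).ne
  have hSH' : S ≤ H := fun v hv => (hSH ▸ hv : v ∈ C ∩ (H : Set V)).2
  obtain ⟨U₁, h1, h2, h3⟩ := hC.exists_axis_through_base hH hSH' hS
  obtain ⟨U₂, h4, h5, h6⟩ := exists_axis_not_through_base hH hSH' hS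
  constructor
  · intro h
    rcases hC.pencil_dichotomy hH hα hSH hS hU hU2 h h4 h5 h6 with h | h
    · exact absurd h.1 hne
    · exact ⟨h.2.1, h.2.2.1⟩
  · intro h
    rcases hC.pencil_dichotomy hH hα hSH hS h1 h2 h3 hU hU2 h with h | h
    · exact absurd h.1 hne
    · exact h.2.2.2

theorem not_exceptional [Finite F] [Finite V] (hC : IsBlockingCone (F := F) C m α β γ)
    {H S : Submodule F V} (hH : finrank F H + 1 = finrank F V) (hα : (C ∩ H).ncard = α)
    (hSH : (S : Set V) = C ∩ H) (hS : finrank F S = m + 1) :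
    C.ncard ≠ Nat.card F ^ m * Nat.card F ^ 3 := by
  classical
  intro hT
  have hq : 1 < Nat.card F := Finite.one_lt_card
  have hd := hC.finrank_eq
  have base_le : ∀ {H S B : Submodule F V}, finrank F H + 1 = finrank F V →
      (C ∩ H).ncard = α → (S : Set V) = C ∩ H → finrank F S = m + 1 →
      finrank F B + 1 = finrank F V → (C ∩ B).ncard = β → S ≤ B := by
    intro H S B hH hα hSH hS hB hβ
    have hne : B ≠ H := by
      rintro rfl
      exact hC.α_ne_β (hα.symm.trans hβ)
    by_contra hSB
    have h := ((hC.exceptional_pencils hT hH hα hSH hS inf_le_right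
      (finrank_inf_add_two hB hH hne)).2 fun h => hSB (h.trans inf_le_left)).1
    rw [Finset.card_eq_zero] at h
    have : B ∈ hyperplanesMeeting C (B ⊓ H) β :=
      mem_hyperplanesMeeting.2 ⟨⟨hB, inf_le_left⟩, hβ⟩
    simp [h] at this
  have through_base : ∀ W : Submodule F V, finrank F W + 1 = finrank F V → S ≤ W → W ≠ H →
      (C ∩ W).ncard = β := by
    intro W hW hSW hne
    have hSH' : S ≤ H := fun v hv => (hSH ▸ hv : v ∈ C ∩ (H : Set V)).2
    have h2 := finrank_inf_add_two hW hH hne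
    obtain ⟨h3, h4⟩ := (hC.exceptional_pencils hT hH hα hSH hS inf_le_right h2).1
      (le_inf hSW hSH')
    have h5 := (hC.counts (W ⊓ H)).1
    rw [card_hyperplanesThrough_of_codim_two (by omega), h3, h4] at h5
    rcases hC.type W hW with h | h | h
    · have h6 : (hyperplanesMeeting C (W ⊓ H) α).card ≤ 1 := by omega
      exact absurd (Finset.card_le_one.1 h6 W
        (mem_hyperplanesMeeting.2 ⟨⟨hW, inf_le_left⟩, h⟩) H
        (mem_hyperplanesMeeting.2 ⟨⟨hH, inf_le_right⟩, hα⟩)) hne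
    · exact h
    · rw [Finset.card_eq_zero] at h4
      have : W ∈ hyperplanesMeeting C (W ⊓ H) γ :=
        mem_hyperplanesMeeting.2 ⟨⟨hW, inf_le_left⟩, h⟩
      simp [h4] at this
  have hSH' : S ≤ H := fun v hv => (hSH ▸ hv : v ∈ C ∩ (H : Set V)).2
  obtain ⟨U, hU, hU2, hSU⟩ := exists_axis_not_through_base hH hSH' hS
  obtain ⟨h1, h2⟩ := (hC.exceptional_pencils hT hH hα hSH hS hU hU2).2 hSU
  have h3 := (hC.counts U).1
  rw [card_hyperplanesThrough_of_codim_two (by omega)] at h3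
  obtain ⟨H', hH', hne⟩ := Finset.exists_mem_ne
    (show 1 < (hyperplanesMeeting C U α).card by omega) H
  obtain ⟨⟨hH'd, -⟩, hα'⟩ := mem_hyperplanesMeeting.1 hH'
  obtain ⟨S', hS'H', hSC', hS'⟩ := hC.exists_base hH'd hα'
  have hSS : ¬ S' ≤ S := by
    intro h
    have h4 := Submodule.eq_of_le_of_finrank_eq h (hS'.trans hS.symm)
    exact hC.α_ne_β (hα'.symm.trans (through_base H' hH'd (h4 ▸ hS'H') hne))
  obtain ⟨s, hs', hs⟩ := SetLike.not_le_iff_exists.1 hSS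
  have h_sub : (hyperplanesThrough S).erase H ⊆ hyperplanesThrough (S ⊔ F ∙ s) := by
    intro W hW
    rw [Finset.mem_erase, mem_hyperplanesThrough] at hW
    obtain ⟨hWH, hWd, hSW⟩ := hW
    refine mem_hyperplanesThrough.2 ⟨hWd, sup_le hSW ?_⟩
    rw [Submodule.span_singleton_le_iff_mem]
    exact base_le hH'd hα' hSC' hS' hWd (through_base W hWd hSW hWH) hs'
  have h_card := Finset.card_le_card h_sub
  rw [Finset.card_erase_of_mem (mem_hyperplanesThrough.2 ⟨hH, hSH'⟩),
    card_hyperplanesThrough_of_codim_three (by omega),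
    card_hyperplanesThrough_of_codim_two
      (by rw [finrank_sup_span_singleton_of_notMem hs]; omega)] at h_card
  have : Nat.card F ^ 2 + Nat.card F ≤ Nat.card F + 1 := by simpa using h_card
  nlinarith

theorem hyperplane_counts [Finite F] [Finite V] (hC : IsBlockingCone (F := F) C m α β γ)
    (h_ex : ∃ H : Submodule F V, finrank F H + 1 = finrank F V ∧ (C ∩ H).ncard = α) :
    C.ncard + Nat.card F ^ m * Nat.card F
        = Nat.card F ^ m * Nat.card F ^ 3 + Nat.card F ^ m * Nat.card F ^ 2 ∧
    (hyperplanesMeeting C (⊥ : Submodule F V) α).card +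
      (hyperplanesMeeting C (⊥ : Submodule F V) γ).card = Nat.card F ^ 2 + Nat.card F + 1 ∧
    (hyperplanesMeeting C (⊥ : Submodule F V) β).card + (Nat.card F ^ 2 + Nat.card F + 1)
      = (hyperplanesThrough (⊥ : Submodule F V)).card ∧
    2 * (hyperplanesMeeting C (⊥ : Submodule F V) γ).card
      = (Nat.card F + 1) * (Nat.card F + 2) := by
  classical
  have hq : 1 < Nat.card F := Finite.one_lt_card
  have hd := hC.finrank_eq
  obtain ⟨H, hH, hα⟩ := h_ex
  obtain ⟨S, hSH', hSH, hS⟩ := hC.exists_base hH hα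
  have hT := hC.not_exceptional hH hα hSH hS
  obtain ⟨U₁, h1, h2, h3⟩ := hC.exists_axis_through_base hH hSH' hS
  obtain ⟨U₂, h4, h5, h6⟩ := exists_axis_not_through_base hH hSH' hS
  have hT' : C.ncard + Nat.card F ^ m * Nat.card F
      = Nat.card F ^ m * Nat.card F ^ 3 + Nat.card F ^ m * Nat.card F ^ 2 :=
    ((hC.pencil_dichotomy hH hα hSH hS h1 h2 h3 h4 h5 h6).resolve_right fun h => hT h.1).1
  have β_iff : ∀ W : Submodule F V, finrank F W + 1 = finrank F V →
      ((C ∩ W).ncard = β ↔ ¬ S ≤ W) := by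
    intro W hW
    by_cases hne : W = H
    · subst hne
      simp [hSH', hα, hC.α_ne_β]
    have h2' := finrank_inf_add_two hW hH hne
    constructor
    · intro hβ hSW
      have h := ((hC.pencil_dichotomy hH hα hSH hS inf_le_right h2' (le_inf hSW hSH')
        h4 h5 h6).resolve_right fun h => hT h.1).2.1
      rw [Finset.card_eq_zero] at h
      have : W ∈ hyperplanesMeeting C (W ⊓ H) β :=
        mem_hyperplanesMeeting.2 ⟨⟨hW, inf_le_left⟩, hβ⟩
      simp [h] at this
    · intro hSW
      obtain ⟨h7, h8⟩ := ((hC.pencil_dichotomy hH hα hSH hS h1 h2 h3 inf_le_right h2'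
        fun h => hSW (h.trans inf_le_left)).resolve_right fun h => hT h.1).2.2.2
      have h9 := (hC.counts (W ⊓ H)).1
      rw [card_hyperplanesThrough_of_codim_two (by omega), h7, h8] at h9
      rcases hC.type W hW with h | h | h
      · have h6 : (hyperplanesMeeting C (W ⊓ H) α).card ≤ 1 := by omega
        exact absurd (Finset.card_le_one.1 h6 W
          (mem_hyperplanesMeeting.2 ⟨⟨hW, inf_le_left⟩, h⟩) H
          (mem_hyperplanesMeeting.2 ⟨⟨hH, inf_le_right⟩, hα⟩)) hne
      · exact h
      · rw [Finset.card_eq_zero] at h8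
        have : W ∈ hyperplanesMeeting C (W ⊓ H) γ :=
          mem_hyperplanesMeeting.2 ⟨⟨hW, inf_le_left⟩, h⟩
        simp [h8] at this
  have restrict : ∀ t, t ≠ β →
      hyperplanesMeeting C (⊥ : Submodule F V) t = hyperplanesMeeting C S t := by
    intro t htβ
    ext W
    simp only [mem_hyperplanesMeeting, bot_le, and_true]
    constructor
    · rintro ⟨hW, ht⟩
      refine ⟨⟨hW, ?_⟩, ht⟩
      by_contra hSW
      exact htβ (ht.symm.trans ((β_iff W hW).2 hSW))
    · rintro ⟨⟨hW, _⟩, ht⟩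
      exact ⟨hW, ht⟩
  have hS3 := card_hyperplanesThrough_of_codim_three (S := S) (by omega)
  have hSβ : (hyperplanesMeeting C S β).card = 0 := by
    rw [Finset.card_eq_zero, Finset.eq_empty_iff_forall_notMem]
    intro W hW
    obtain ⟨⟨hWd, hSW⟩, hβ⟩ := mem_hyperplanesMeeting.1 hW
    exact (β_iff W hWd).1 hβ hSW
  obtain ⟨h_cnt, h_sum⟩ := hC.counts S
  have h_bot := (hC.counts ⊥).1
  have h_double := sum_ncard_inter_hyperplanesThrough S C (r := Nat.card F + 1) fun v hv =>
    card_hyperplanesThrough_of_codim_two (by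
      rw [finrank_sup_span_singleton_of_notMem hv]; omega)
  rw [ncard_inter_of_base_le hSH hSH' hS le_rfl, h_sum, hSβ, hS3] at h_double
  rw [hS3, hSβ] at h_cnt
  have hα' := restrict α hC.α_ne_β
  have hγ' := restrict γ hC.β_ne_γ.symm
  rw [hα', hγ'] at h_bot ⊢
  refine ⟨hT', by omega, by omega, ?_⟩
  have hα_eq := hC.α_eq
  have hγ_eq := hC.γ_eq
  have hQ : 0 < Nat.card F ^ m := by positivity
  clear hα' hγ' restrict β_iff h_sum h_bot hT
  generalize (hyperplanesMeeting C S γ).card = y at *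
  generalize (hyperplanesMeeting C S α).card = z at *
  generalize Nat.card F ^ m = Q at *
  generalize Nat.card F = q at *
  generalize C.ncard = T at *
  zify at *
  have hz : (z : ℤ) = q ^ 2 + q + 1 - y := by linarith
  have hγ2 : (γ : ℤ) = 2 * Q * q ^ 2 - Q * q := by linarith
  have hT2 : (T : ℤ) = Q * q ^ 3 + Q * q ^ 2 - Q * q := by linarith
  rw [hα_eq, hγ2, hz, hT2] at h_double
  have hpos : (Q : ℤ) * q * (q - 1) ≠ 0 := by
    have : (0 : ℤ) < q - 1 := by linarith
    positivity
  refine mul_left_cancel₀ hpos ?_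
  linarith

end IsBlockingCone

end Counting

section ProjectivePoints

variable {F} {n : ℕ}

/-- The vectors representing points of `K`, together with zero. -/
def coneOver (K : Set (PGPoint F n)) : Set (Fin (n + 1) → F) :=
  {v | ∀ h : v ≠ 0, Projectivization.mk F v h ∈ K}

theorem zero_mem_coneOver (K : Set (PGPoint F n)) : 0 ∈ coneOver K := fun h => absurd rfl h

theorem smul_mem_coneOver {K : Set (PGPoint F n)} (t : F) {v : Fin (n + 1) → F}
    (hv : v ∈ coneOver K) : t • v ∈ coneOver K := by
  intro h
  have hv0 : v ≠ 0 := right_ne_zero_of_smul h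
  have : Projectivization.mk F (t • v) h = Projectivization.mk F v hv0 :=
    (Projectivization.mk_eq_mk_iff' F _ _ _ _).2 ⟨t, rfl⟩
  rw [this]
  exact hv hv0

theorem mk_mem_projSet {W : Submodule F (Fin (n + 1) → F)} {v : Fin (n + 1) → F} (h : v ≠ 0) :
    Projectivization.mk F v h ∈ projSet F n W ↔ v ∈ W := by
  change (Projectivization.mk F v h).submodule ≤ W ↔ v ∈ W
  rw [Projectivization.submodule_mk, Submodule.span_singleton_le_iff_mem]

theorem ncard_coneOver_inter [Finite F] (K : Set (PGPoint F n))
    (W : Submodule F (Fin (n + 1) → F)) :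
    (coneOver K ∩ W).ncard = (K ∩ projSet F n W).ncard * (Nat.card F - 1) + 1 := by
  rw [← Set.ncard_sdiff_singleton_add_one (s := coneOver K ∩ W) (a := 0)
      ⟨zero_mem_coneOver K, W.zero_mem⟩,
    ← Set.ncard_image_of_injective (K ∩ projSet F n W) Projectivization.submodule_injective]
  congr 1
  refine ncard_eq_mul_of_fibers (Set.toFinite _) (fun v => F ∙ v) ?_ ?_
  · rintro v ⟨⟨hvC, hvW⟩, hv0⟩
    exact ⟨Projectivization.mk F v hv0, ⟨hvC hv0, (mk_mem_projSet hv0).2 hvW⟩,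
      Projectivization.submodule_mk v hv0⟩
  · rintro _ ⟨P, ⟨hPK, hPW⟩, rfl⟩
    have h1 := ncard_nonzero_add_one P.submodule
    rw [P.finrank_submodule, pow_one] at h1
    rw [← h1, Nat.add_sub_cancel]
    congr 1
    ext v
    constructor
    · rintro ⟨⟨-, hv0⟩, hv⟩
      exact ⟨hv ▸ Submodule.mem_span_singleton_self v, hv0⟩
    · rintro ⟨hvP, hv0⟩
      have hmk : Projectivization.mk F v hv0 = P := by
        apply Projectivization.submodule_injective
        refine Submodule.eq_of_le_of_finrank_eq ?_ ?_
        · rw [Projectivization.submodule_mk]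
          exact (Submodule.span_singleton_le_iff_mem _ _).2 hvP
        · rw [Projectivization.finrank_submodule, Projectivization.finrank_submodule]
      refine ⟨⟨⟨fun _ => hmk ▸ hPK, hPW hvP⟩, hv0⟩, ?_⟩
      rw [← hmk, Projectivization.submodule_mk]

theorem ncard_coneOver [Finite F] (K : Set (PGPoint F n)) :
    (coneOver K).ncard = K.ncard * (Nat.card F - 1) + 1 := by
  have h := ncard_coneOver_inter K ⊤
  have htop : projSet F n ⊤ = Set.univ := Set.eq_univ_of_forall fun P =>
    (le_top : P.submodule ≤ ⊤)
  rwa [htop, Set.inter_univ, Submodule.top_coe, Set.inter_univ] at h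

theorem tnum_eq_card_hyperplanesMeeting [Finite F] (K : Set (PGPoint F n)) (t : ℕ) :
    tnum F n K t = (hyperplanesMeeting (coneOver K) (⊥ : Submodule F (Fin (n + 1) → F))
      (t * (Nat.card F - 1) + 1)).card := by
  have hq : 1 < Nat.card F := Finite.one_lt_card
  rw [← Set.ncard_coe_finset, tnum]
  congr 1
  ext W
  have : 0 < Nat.card F - 1 := by omega
  simp [mem_hyperplanesMeeting, ncard_coneOver_inter, this.ne']

end ProjectivePoints

theorem theta_mul_sub_one_add_one {q : ℕ} (hq : 2 ≤ q) (m : ℕ) :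
    theta q m * (q - 1) + 1 = q ^ (m + 1) := by
  have h : q - 1 ∣ q ^ (m + 1) - 1 := by simpa using Nat.sub_dvd_pow_sub_pow q 1 (m + 1)
  rw [theta, Nat.div_mul_cancel h, Nat.sub_add_cancel (Nat.one_le_pow _ _ (by omega))]

/-- In `PG(n,q)`, `n ≥ 4`, if `K` is a plane blocking set of type
`(θ_{n-3}, θ_{n-2} + q^{n-3}, θ_{n-2} + q^{n-2})_{n-1}`, then `k = θ_{n-1} + q^{n-2}`,
`t_a = (q²-q)/2`, `t_b = θ_n - θ_2` and `t_c = (q²+3q+2)/2`. -/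
theorem statement18 [Fintype F] (q n : ℕ) (hq : Fintype.card F = q) (hn : 4 ≤ n)
    (K : Set (PGPoint F n)) (hblock : BlocksDim F n 2 K)
    (hK : IsType3 F n K (theta q (n - 3)) (theta q (n - 2) + q ^ (n - 3))
      (theta q (n - 2) + q ^ (n - 2))) :
    K.ncard = theta q (n - 1) + q ^ (n - 2) ∧
    tnum F n K (theta q (n - 3)) = (q ^ 2 - q) / 2 ∧
    tnum F n K (theta q (n - 2) + q ^ (n - 3)) = theta q n - theta q 2 ∧
    tnum F n K (theta q (n - 2) + q ^ (n - 2)) = (q ^ 2 + 3 * q + 2) / 2 := by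
  obtain ⟨m, rfl⟩ : ∃ m, n = m + 3 := ⟨n - 3, by omega⟩
  have hcard : Nat.card F = q := by rw [Nat.card_eq_fintype_card, hq]
  have hq2 : 2 ≤ q := hq ▸ Fintype.one_lt_card
  simp only [Nat.add_sub_cancel, show m + 3 - 2 = m + 1 by omega,
    show m + 3 - 1 = m + 2 by omega] at hK ⊢
  have hθ := theta_mul_sub_one_add_one hq2
  obtain ⟨p, rfl⟩ : ∃ p, q = p + 1 := ⟨q - 1, by omega⟩
  simp only [Nat.add_sub_cancel] at hθ
  have hθ0 := hθ m
  have hθ1 := hθ (m + 1)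
  have hθ2 := hθ (m + 2)
  have hθ3 := hθ (m + 3)
  have hθt : theta (p + 1) 2 * p + 1 = (p + 1) ^ 3 := hθ 2
  obtain ⟨h_type, ⟨H, hH, hHa⟩, -, -⟩ := hK
  have hC : IsBlockingCone (F := F) (coneOver K) m (theta (p + 1) m * p + 1)
      ((theta (p + 1) (m + 1) + (p + 1) ^ m) * p + 1)
      ((theta (p + 1) (m + 1) + (p + 1) ^ (m + 1)) * p + 1) := by
    refine ⟨zero_mem_coneOver K, fun t v hv => smul_mem_coneOver t hv, ?_, by simp, ?_, ?_, ?_, ?_⟩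
    · intro W hW
      obtain ⟨P, hPK, hPW⟩ := hblock W hW
      refine ⟨P.rep, hPW (by rw [Projectivization.submodule_eq]; exact
        Submodule.mem_span_singleton_self _), fun _ => ?_, P.rep_nonzero⟩
      rw [P.mk_rep]
      exact hPK
    · intro W hW
      rw [ncard_coneOver_inter, hcard, Nat.add_sub_cancel]
      rcases h_type W (by simpa using hW) with h | h | h <;> simp [h]
    · rw [hcard, hθ0, pow_succ]
    · rw [hcard]
      linear_combination hθ1
    · rw [hcard]
      linear_combination hθ1
  obtain ⟨h1, h2, h3, h4⟩ := hC.hyperplane_counts ⟨H, by simp [hH], by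
    rw [ncard_coneOver_inter, hHa, hcard, Nat.add_sub_cancel]⟩
  have h5 := card_hyperplanesThrough (⊥ : Submodule F (Fin (m + 3 + 1) → F))
  rw [ncard_coneOver] at h1
  simp only [hcard, Nat.add_sub_cancel, finrank_bot, Module.finrank_fin_fun, Nat.sub_zero]
    at h1 h2 h3 h4 h5
  simp only [tnum_eq_card_hyperplanesMeeting, hcard, Nat.add_sub_cancel]
  have hp : 0 < p := by omega
  have h6 : (hyperplanesThrough (⊥ : Submodule F (Fin (m + 3 + 1) → F))).card
      = theta (p + 1) (m + 3) :=
    Nat.eq_of_mul_eq_mul_right hp (by omega)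
  have h7 : theta (p + 1) 2 = (p + 1) ^ 2 + (p + 1) + 1 :=
    Nat.eq_of_mul_eq_mul_right hp (by linarith)
  refine ⟨?_, ?_, by omega, ?_⟩
  · refine Nat.eq_of_mul_eq_mul_right hp ?_
    have h8 : (p + 1) ^ (m + 2 + 1) = (p + 1) ^ m * (p + 1) ^ 3 := by ring
    rw [h8] at hθ2
    rw [show (p + 1) ^ (m + 1) = (p + 1) ^ m * (p + 1) by ring]
    generalize (p + 1) ^ m = Q at *
    linarith
  · symm
    apply Nat.div_eq_of_eq_mul_right (by norm_num)
    have : (p + 1) ^ 2 - (p + 1) = p ^ 2 + p := by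
      rw [show (p + 1) ^ 2 = p ^ 2 + p + (p + 1) by ring, Nat.add_sub_cancel]
    rw [this]
    linarith
  · symm
    apply Nat.div_eq_of_eq_mul_right (by norm_num)
    linarith
end
end

section
/- In PG(n,q), with n ≥ 5, let d satisfy 2 ≤ d ≤ q−1 and gcd(d−1, q) = 1, and let K be a plane blocking set of type (a,b,c)_{n-1} with a = θ_{n-3}, b = q^{n−3}(qd+d−q) + θ_{n-4} and c = q^{n−2}d + θ_{n-3}. Then k = q^{n−2}(qd+d−q) + θ_{n-3}, t_a = q(q+1−d)/d, t_b = θ_n − θ_2 and t_c = (q+1)(qd+d−q)/d. -/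
open Module Set

noncomputable section

variable (F : Type) [Field F]

theorem strictMono_sum_pow {q : ℕ} (hq : 0 < q) :
    StrictMono fun r => ∑ i ∈ Finset.range r, q ^ i :=
  strictMono_nat_of_lt_succ fun r => by
    rw [Finset.sum_range_succ]
    exact Nat.lt_add_of_pos_right (pow_pos hq r)

theorem pencil_arithmetic_s19 {q d m Q A A' x α β γ α' β' γ' : ℤ} (hd : 2 ≤ d) (hdq : d < q)
    (hcop : IsCoprime q (d - 1)) (hm : m + q = q * d + d) (hQ : 0 < Q) (hA : A = A' + Q)
    (hα : 1 ≤ α) (hβ : 0 ≤ β) (hγ : 0 ≤ γ) (hα' : 1 ≤ α') (hβ' : 0 ≤ β') (hγ' : 0 ≤ γ')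
    (h1 : α + β + γ = q + 1) (h1' : α' + β' + γ' = q + 1)
    (h2 : A * α + (Q * m + A') * β + (Q * q * d + A) * γ = A * (q + 1) + x)
    (h2' : A * α' + (Q * m + A') * β' + (Q * q * d + A) * γ' = A' * (q + 1) + (x + Q)) :
    (β = 0 ∧ β' = q ∧ x = Q * q * m) ∨
      (β = q ∧ β' = 0 ∧ x + Q * q = Q * q * m ∧ 2 ≤ α') := by
  subst hA
  obtain rfl : m = q * d + d - q := by linarith
  obtain rfl : α = q + 1 - β - γ := by linarith
  obtain rfl : α' = q + 1 - β' - γ' := by linarith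
  have e1 : x = Q * ((q + 1) * (d - 1) * β + q * d * γ) := by linear_combination -h2
  have e2 : (q + 1) * (d - 1) * β' + q * d * γ' + q = (q + 1) * (d - 1) * β + q * d * γ := by
    refine mul_left_cancel₀ hQ.ne' ?_
    rw [← e1]
    linear_combination h2'
  have hdvd : q ∣ β - β' := by
    refine hcop.dvd_of_dvd_mul_left ⟨1 - d * (γ - γ') - (d - 1) * (β - β'), ?_⟩
    linear_combination -e2
  obtain ⟨t, ht⟩ := hdvd
  have ht1 : t ≤ 1 := by by_contra! h; nlinarith
  have ht2 : -1 ≤ t := by by_contra! h; nlinarith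
  obtain rfl | rfl | rfl : t = -1 ∨ t = 0 ∨ t = 1 := by omega
  · left
    obtain rfl : β = 0 := by linarith
    obtain rfl : β' = q := by linarith
    obtain rfl : γ' = 0 := by linarith
    refine ⟨rfl, rfl, ?_⟩
    rw [e1, ← e2]
    ring
  · exfalso
    obtain rfl : β = β' := by linarith
    have h : d * (γ - γ') = 1 := by
      refine mul_left_cancel₀ (show q ≠ 0 by omega) ?_
      linear_combination -e2
    have := Int.le_of_dvd one_pos (Dvd.intro _ h)
    omega
  · right
    obtain rfl : β = q := by linarith
    obtain rfl : β' = 0 := by linarith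
    obtain rfl : γ = 0 := by linarith
    refine ⟨rfl, rfl, ?_, ?_⟩
    · rw [e1]
      ring
    · by_contra! h
      have : γ' = β := by linarith
      subst this
      have : (γ' - d + 2) * γ' = 0 := by linear_combination e2
      rcases mul_eq_zero.mp this with h | h <;> omega

section Counting

variable {F} {V : Type*} [AddCommGroup V] [Module F V]

/-- The points of the projective space lying in a linear subspace. -/
def points (W : Submodule F V) : Set (Projectivization F V) := {x | x.submodule ≤ W}

theorem mem_points {W : Submodule F V} {x : Projectivization F V} :
    x ∈ points W ↔ x.submodule ≤ W := Iff.rfl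

theorem points_mono {W W' : Submodule F V} (h : W ≤ W') : points W ⊆ points W' :=
  fun _ hx => le_trans hx h

theorem points_subset_iff {X Y : Submodule F V} : points X ⊆ points Y ↔ X ≤ Y := by
  refine ⟨fun h v hv => ?_, points_mono⟩
  rcases eq_or_ne v 0 with rfl | hv0
  · exact Y.zero_mem
  · have := @h (Projectivization.mk F v hv0) (by
      rwa [mem_points, Projectivization.submodule_mk, Submodule.span_singleton_le_iff_mem])
    rwa [mem_points, Projectivization.submodule_mk, Submodule.span_singleton_le_iff_mem] at this

theorem points_inf (X Y : Submodule F V) : points (X ⊓ Y) = points X ∩ points Y := by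
  ext x
  exact (le_inf_iff : x.submodule ≤ X ⊓ Y ↔ _)

/-- The hyperplanes containing `X`. -/
def hyperplanesOver (X : Submodule F V) : Set (Submodule F V) :=
  {W | X ≤ W ∧ finrank F W + 1 = finrank F V}

/-- The number of hyperplanes containing `X` and meeting `K` in exactly `m` points. -/
def hyperplaneCount (K : Set (Projectivization F V)) (X : Submodule F V) (m : ℕ) : ℕ :=
  {W ∈ hyperplanesOver X | (K ∩ points W).ncard = m}.ncard

theorem hyperplaneCount_bot_eq (K : Set (Projectivization F V)) {S : Submodule F V} {l : ℕ}
    (hl : ∀ W ∈ hyperplanesOver (⊥ : Submodule F V), (K ∩ points W).ncard = l → S ≤ W) :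
    hyperplaneCount K ⊥ l = hyperplaneCount K S l := by
  refine congrArg Set.ncard (Set.ext fun W => ?_)
  exact ⟨fun hW => ⟨⟨hl W hW.1 hW.2, hW.1.2⟩, hW.2⟩, fun hW => ⟨⟨bot_le, hW.1.2⟩, hW.2⟩⟩

/-- The intersection numbers attached to a cone with vertex of vector space dimension `e + 1`. -/
structure ConeType (F : Type) [Field F] {V : Type*} [AddCommGroup V] [Module F V]
    (q d m e a b c : ℕ) (K : Set (Projectivization F V)) : Prop where
  finrank_eq : finrank F V = e + 4
  card_eq : Nat.card F = q
  two_le : 2 ≤ d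
  lt_card : d < q
  coprime : Nat.Coprime (d - 1) q
  m_add : m + q = q * d + d
  a_eq : a = ∑ i ∈ Finset.range (e + 1), q ^ i
  b_eq : b = q ^ e * m + ∑ i ∈ Finset.range e, q ^ i
  c_eq : c = q ^ (e + 1) * d + ∑ i ∈ Finset.range (e + 1), q ^ i
  type : ∀ W : Submodule F V, finrank F W + 1 = finrank F V →
    (K ∩ points W).ncard = a ∨ (K ∩ points W).ncard = b ∨ (K ∩ points W).ncard = c

namespace ConeType

variable {q d m e a b c : ℕ} {K : Set (Projectivization F V)}

theorem a_lt_b (h : ConeType F q d m e a b c K) : a < b := by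
  have hm : 2 ≤ m := by nlinarith [h.two_le, h.m_add, h.lt_card]
  have hQ : 0 < q ^ e := pow_pos (by have := h.lt_card; omega) e
  rw [h.a_eq, h.b_eq, Finset.sum_range_succ]
  nlinarith

theorem b_lt_c (h : ConeType F q d m e a b c K) : b < c := by
  have hm : m < q * d + 1 := by linarith [h.m_add, h.lt_card]
  have hQ : 0 < q ^ e := pow_pos (by have := h.lt_card; omega) e
  rw [h.b_eq, h.c_eq, Finset.sum_range_succ, pow_succ]
  nlinarith

theorem not_top_le (h : ConeType F q d m e a b c K) {S : Submodule F V}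
    (hS : finrank F S = e + 1) : ¬ ⊤ ≤ S := by
  intro hle
  have h1 := h.finrank_eq
  rw [top_le_iff.mp hle, finrank_top] at hS
  omega

end ConeType

section FiniteDimensional

variable [FiniteDimensional F V]

theorem finrank_sup_submodule {X : Submodule F V} {x : Projectivization F V} (hx : x ∉ points X) :
    finrank F ↥(X ⊔ x.submodule) = finrank F X + 1 := by
  have h1 := Submodule.finrank_sup_add_finrank_inf_eq X x.submodule
  have h2 : finrank F ↥(X ⊓ x.submodule) = 0 := by
    by_contra h0
    apply hx
    have h3 : X ⊓ x.submodule = x.submodule :=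
      Submodule.eq_of_le_of_finrank_le inf_le_right
        (by rw [x.finrank_submodule]; omega)
    exact inf_eq_right.mp h3
  rw [x.finrank_submodule] at h1
  omega

theorem sup_mem_covers {U H : Submodule F V} (hUH : U ≤ H) {x : Projectivization F V}
    (hxH : x ∈ points H) (hxU : x ∉ points U) :
    U ⊔ x.submodule ∈ {Y : Submodule F V | U ≤ Y ∧ Y ≤ H ∧ finrank F Y = finrank F U + 1} :=
  ⟨le_sup_left, sup_le hUH hxH, finrank_sup_submodule hxU⟩

theorem sup_eq_of_mem_points {U Y : Submodule F V} (hUY : U ≤ Y)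
    (hY : finrank F Y = finrank F U + 1) {x : Projectivization F V}
    (hxY : x ∈ points Y) (hxU : x ∉ points U) : U ⊔ x.submodule = Y :=
  Submodule.eq_of_le_of_finrank_le (sup_le hUY hxY) (by rw [finrank_sup_submodule hxU, hY])

theorem mem_hyperplanesOver_inf {W H : Submodule F V} {e : ℕ} (hV : finrank F V = e + 4)
    (hH : finrank F H = e + 3) (hW : finrank F W = e + 3) (hne : W ≠ H) :
    finrank F ↥(W ⊓ H) + (1 + 1) = finrank F V ∧ H ∈ hyperplanesOver (W ⊓ H) ∧
      W ∈ hyperplanesOver (W ⊓ H) := by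
  refine ⟨?_, ⟨inf_le_right, by omega⟩, ⟨inf_le_left, by omega⟩⟩
  have h1 := Submodule.finrank_sup_add_finrank_inf_eq W H
  have h2 : finrank F ↥(W ⊔ H) ≤ finrank F V := Submodule.finrank_le _
  have h3 : e + 3 < finrank F ↥(W ⊔ H) := by
    rw [← hH]
    refine Submodule.finrank_lt_finrank_of_lt (lt_of_le_of_ne le_sup_right fun h => hne ?_)
    exact Submodule.eq_of_le_of_finrank_le (h ▸ le_sup_left) (by omega)
  omega

theorem finrank_inf_hyperplane {S W : Submodule F V}
    (hW : finrank F W + 1 = finrank F V) (hSW : ¬ S ≤ W) :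
    finrank F ↥(S ⊓ W) + 1 = finrank F S := by
  have h1 := Submodule.finrank_sup_add_finrank_inf_eq S W
  have h2 : finrank F ↥(S ⊔ W) ≤ finrank F V := Submodule.finrank_le _
  have h3 : finrank F W < finrank F ↥(S ⊔ W) :=
    Submodule.finrank_lt_finrank_of_lt (lt_of_le_of_ne le_sup_right fun h => hSW (h ▸ le_sup_left))
  omega

end FiniteDimensional

variable [Finite F]

theorem ncard_points (W : Submodule F V) :
    (points W).ncard = ∑ i ∈ Finset.range (finrank F W), Nat.card F ^ i := by
  rw [← Projectivization.card_of_finrank F W rfl, ← Set.ncard_univ,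
    ← Set.ncard_image_of_injective _ (Projectivization.map_injective W.subtype W.subtype_injective),
    Set.image_univ]
  congr 1
  ext x
  induction x using Projectivization.ind with
  | h v hv =>
    rw [mem_points, Projectivization.submodule_mk, Submodule.span_singleton_le_iff_mem]
    constructor
    · intro hvW
      refine ⟨Projectivization.mk F ⟨v, hvW⟩ (by simpa using hv), ?_⟩
      simp [Projectivization.map_mk]
    · rintro ⟨y, hy⟩
      induction y using Projectivization.ind with
      | h w hw =>
        rw [Projectivization.map_mk, eq_comm, Projectivization.mk_eq_mk_iff'] at hy
        obtain ⟨a, ha⟩ := hy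
        exact ha ▸ W.smul_mem a w.2

theorem ncard_lines (W : Submodule F V) :
    {L : Submodule F V | L ≤ W ∧ finrank F L = 1}.ncard =
      ∑ i ∈ Finset.range (finrank F W), Nat.card F ^ i := by
  rw [← ncard_points, ← Set.ncard_image_of_injective _ Projectivization.submodule_injective]
  congr 1
  ext L
  constructor
  · rintro ⟨hL, h1⟩
    exact ⟨Projectivization.mk'' L h1, by simpa [mem_points] using hL, by simp⟩
  · rintro ⟨x, hx, rfl⟩
    exact ⟨hx, x.finrank_submodule⟩

variable [FiniteDimensional F V]

theorem finite_submodule : Finite (Submodule F V) :=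
  have : Finite V := Module.finite_of_finite F
  inferInstance

theorem finite_projectivization : Finite (Projectivization F V) :=
  have : Finite V := Module.finite_of_finite F
  inferInstance

theorem ncard_hyperplanesOver {X : Submodule F V} {r : ℕ} (h : finrank F X + r = finrank F V) :
    (hyperplanesOver X).ncard = ∑ i ∈ Finset.range r, Nat.card F ^ i := by
  have hr : r = finrank F X.dualAnnihilator := by
    have := Subspace.finrank_add_finrank_dualAnnihilator_eq X
    omega
  rw [hr, ← ncard_lines]
  refine Set.ncard_congr (fun W _ => W.dualAnnihilator) ?_ ?_ ?_
  · rintro W ⟨h1, h2⟩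
    refine ⟨Submodule.dualAnnihilator_anti h1, ?_⟩
    have := Subspace.finrank_add_finrank_dualAnnihilator_eq W
    omega
  · intro W W' _ _ h
    exact Subspace.dualAnnihilator_inj.mp h
  · rintro L ⟨h1, h2⟩
    refine ⟨L.dualCoannihilator, ⟨?_, ?_⟩, Subspace.dualCoannihilator_dualAnnihilator_eq⟩
    · exact (Submodule.dualAnnihilator_gc F V).le_iff_le.mp h1
    · have := Subspace.finrank_add_finrank_dualCoannihilator_eq L
      omega

theorem ncard_covers {U H : Submodule F V} {r : ℕ} (hUH : U ≤ H)
    (h : finrank F U + r = finrank F H) :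
    {Y : Submodule F V | U ≤ Y ∧ Y ≤ H ∧ finrank F Y = finrank F U + 1}.ncard =
      ∑ i ∈ Finset.range r, Nat.card F ^ i := by
  have key : ∀ Y : Submodule F V, U ≤ Y →
      finrank F (Y.map U.mkQ) + finrank F U = finrank F Y := by
    intro Y hY
    have h1 := LinearMap.finrank_range_add_finrank_ker (U.mkQ.domRestrict Y)
    rw [LinearMap.range_domRestrict, LinearMap.ker_domRestrict, Submodule.ker_mkQ] at h1
    rw [← h1, (Submodule.comapSubtypeEquivOfLe hY).finrank_eq]
  have hr : r = finrank F (H.map U.mkQ) := by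
    have := key H hUH
    omega
  rw [hr, ← ncard_lines]
  refine Set.ncard_congr (fun Y _ => Y.map U.mkQ) ?_ ?_ ?_
  · rintro Y ⟨h1, h2, h3⟩
    have := key Y h1
    exact ⟨Submodule.map_mono h2, by omega⟩
  · rintro Y Y' ⟨h1, -⟩ ⟨h2, -⟩ h
    have h := congrArg (Submodule.comap U.mkQ) h
    simpa [Submodule.comap_map_mkQ, sup_eq_right.mpr h1, sup_eq_right.mpr h2] using h
  · rintro L ⟨h1, h2⟩
    have hL : (L.comap U.mkQ).map U.mkQ = L :=
      Submodule.map_comap_eq_of_surjective U.mkQ_surjective L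
    have hU : U ≤ L.comap U.mkQ := Submodule.le_comap_mkQ U L
    refine ⟨L.comap U.mkQ, ⟨hU, ?_, ?_⟩, hL⟩
    · have := Submodule.comap_mono (f := U.mkQ) h1
      rwa [Submodule.comap_map_mkQ, sup_eq_right.mpr hUH] at this
    · have := key _ hU
      rw [hL] at this
      omega

theorem sum_ncard_inter_hyperplanesOver (K : Set (Projectivization F V)) {X : Submodule F V} {r : ℕ}
    (h : finrank F X + (r + 1) = finrank F V) (s : Finset (Submodule F V))
    (hs : ∀ W, W ∈ s ↔ W ∈ hyperplanesOver X) :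
    ∑ W ∈ s, (K ∩ points W).ncard =
      (K ∩ points X).ncard * ∑ i ∈ Finset.range (r + 1), Nat.card F ^ i +
        (K \ points X).ncard * ∑ i ∈ Finset.range r, Nat.card F ^ i := by
  classical
  have := finite_projectivization (F := F) (V := V)
  have : Fintype (Projectivization F V) := Fintype.ofFinite _
  have hsX : ∀ Y : Submodule F V, X ≤ Y → ∀ t, finrank F Y + t = finrank F V →
      (s.filter (fun W => Y ≤ W)).card = ∑ i ∈ Finset.range t, Nat.card F ^ i := by
    intro Y hY t ht
    rw [← ncard_hyperplanesOver ht, ← Set.ncard_coe_finset]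
    congr 1
    ext W
    simp only [Finset.coe_filter, hs, hyperplanesOver, Set.mem_ofPred_eq]
    exact ⟨fun h => ⟨h.2, h.1.2⟩, fun h => ⟨⟨hY.trans h.1, h.2⟩, h.1⟩⟩
  have hcard : ∀ A : Set (Projectivization F V), A.ncard = A.toFinset.card :=
    fun A => Set.ncard_eq_toFinset_card' A
  have hpt : ∀ x : Projectivization F V,
      (s.filter (fun W => x.submodule ≤ W)).card =
        if x ∈ points X then ∑ i ∈ Finset.range (r + 1), Nat.card F ^ i
        else ∑ i ∈ Finset.range r, Nat.card F ^ i := by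
    intro x
    split_ifs with hx
    · rw [← hsX X le_rfl _ h]
      congr 1
      ext W
      simp only [Finset.mem_filter, and_congr_right_iff, hs]
      exact fun hW => ⟨fun _ => hW.1, fun h => le_trans hx h⟩
    · rw [← hsX (X ⊔ x.submodule) le_sup_left r (by rw [finrank_sup_submodule hx]; omega)]
      congr 1
      ext W
      simp only [Finset.mem_filter, and_congr_right_iff, hs]
      exact fun hW => ⟨fun h => sup_le hW.1 h, fun h => le_sup_right.trans h⟩
  have hswap := Finset.sum_card_bipartiteAbove_eq_sum_card_bipartiteBelow
    (s := s) (t := K.toFinset) (fun W (x : Projectivization F V) => x.submodule ≤ W)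
  simp only [Finset.bipartiteAbove, Finset.bipartiteBelow, hpt] at hswap
  rw [Finset.sum_ite, Finset.sum_const, Finset.sum_const, smul_eq_mul, smul_eq_mul] at hswap
  rw [hcard, hcard]
  convert hswap using 2
  · rw [hcard]
    congr 1
    ext x
    simp [mem_points]
  · congr 2
    ext x
    simp
  · congr 2
    ext x
    simp

/-- A subspace disjoint from a small set of points has a disjoint cover. -/
theorem exists_cover_disjoint {U H : Submodule F V} {r : ℕ} (hUH : U ≤ H)
    (h : finrank F U + r = finrank F H) {B : Set (Projectivization F V)}
    (hBU : Disjoint B (points U)) (hB : B.ncard < ∑ i ∈ Finset.range r, Nat.card F ^ i) :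
    ∃ Y : Submodule F V, U ≤ Y ∧ Y ≤ H ∧ finrank F Y = finrank F U + 1 ∧ Disjoint B (points Y) := by
  have := finite_projectivization (F := F) (V := V)
  by_contra! hcon
  refine hB.not_ge ?_
  rw [← ncard_covers hUH h]
  refine le_trans (Set.ncard_le_ncard ?_ (Set.toFinite _))
    (Set.ncard_image_le (f := fun x => U ⊔ x.submodule) (Set.toFinite B))
  rintro Y ⟨h1, h2, h3⟩
  obtain ⟨x, hxB, hxY⟩ := Set.not_disjoint_iff.mp (hcon Y h1 h2 h3)
  exact ⟨x, hxB, sup_eq_of_mem_points h1 h3 hxY (hBU.notMem_of_mem_left hxB)⟩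

/-- If a set of points has exactly as many points as a subspace `U` disjoint from it has covers,
and it meets all of these covers, then it meets each of them only once. -/
theorem eq_of_sup_eq_of_ncard_eq {U H : Submodule F V} {r : ℕ} (hUH : U ≤ H)
    (h : finrank F U + r = finrank F H) {B : Set (Projectivization F V)} (hBH : B ⊆ points H)
    (hBU : Disjoint B (points U)) (hB : B.ncard = ∑ i ∈ Finset.range r, Nat.card F ^ i)
    (hblock : ∀ Y : Submodule F V, Y ≤ H → finrank F Y = finrank F U + 1 → (B ∩ points Y).Nonempty)
    {x y : Projectivization F V} (hx : x ∈ B) (hy : y ∈ B)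
    (hxy : U ⊔ x.submodule = U ⊔ y.submodule) : x = y := by
  have := finite_projectivization (F := F) (V := V)
  have := finite_submodule (F := F) (V := V)
  refine Set.inj_on_of_surj_on_of_ncard_le (s := B) (fun x _ => U ⊔ x.submodule)
    (fun z hz => sup_mem_covers hUH (hBH hz) (hBU.notMem_of_mem_left hz)) ?_
    (by rw [hB, ncard_covers hUH h]) hx hy hxy
  rintro Y ⟨h1, h2, h3⟩
  obtain ⟨z, hzB, hzY⟩ := hblock Y h2 h3
  exact ⟨z, hzB, sup_eq_of_mem_points h1 h3 hzY (hBU.notMem_of_mem_left hzB)⟩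

/-- A smallest plane blocking set is a subspace. -/
theorem exists_eq_points_of_blocking {H : Submodule F V} {B : Set (Projectivization F V)} {r : ℕ}
    (hH : finrank F H = r + 2) (hBH : B ⊆ points H)
    (hB : B.ncard = ∑ i ∈ Finset.range r, Nat.card F ^ i)
    (hblock : ∀ Y : Submodule F V, Y ≤ H → finrank F Y = 3 → (B ∩ points Y).Nonempty) :
    ∃ S : Submodule F V, S ≤ H ∧ finrank F S = r ∧ B = points S := by
  have hmono := strictMono_sum_pow (Nat.card_pos (α := F))
  have hline : ∀ x ∈ B, ∀ y ∈ B, ∀ z : Projectivization F V,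
      z.submodule ≤ x.submodule ⊔ y.submodule → z ∈ B := by
    intro x hx y hy z hz
    by_contra hzB
    have hdisj : ∀ w ∈ B, w ∉ points z.submodule := by
      intro w hw hwz
      have : w.submodule = z.submodule := Submodule.eq_of_le_of_finrank_le hwz
        (by rw [w.finrank_submodule, z.finrank_submodule])
      exact hzB (Projectivization.submodule_injective this ▸ hw)
    have hzH : z.submodule ≤ H := hz.trans (sup_le (hBH hx) (hBH hy))
    obtain ⟨U, hzU, hUH, hU, hBU⟩ := exists_cover_disjoint (r := r + 1) hzH
      (by rw [z.finrank_submodule]; omega) (Set.disjoint_left.mpr hdisj)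
      (by rw [hB]; exact hmono (Nat.lt_succ_self r))
    rw [z.finrank_submodule] at hU
    have hxy : x ≠ y := by
      rintro rfl
      rw [sup_idem] at hz
      have : z.submodule = x.submodule := Submodule.eq_of_le_of_finrank_le hz
        (by rw [x.finrank_submodule, z.finrank_submodule])
      exact hzB (Projectivization.submodule_injective this ▸ hx)
    have hxy2 : finrank F ↥(x.submodule ⊔ y.submodule) = 2 := by
      rw [finrank_sup_submodule, x.finrank_submodule]
      intro h
      have : y.submodule = x.submodule := Submodule.eq_of_le_of_finrank_le h
        (by rw [x.finrank_submodule, y.finrank_submodule])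
      exact hxy (Projectivization.submodule_injective this).symm
    have hjoin : ∀ w ∈ B, w.submodule ≤ x.submodule ⊔ y.submodule →
        U ⊔ w.submodule = U ⊔ (x.submodule ⊔ y.submodule) := by
      intro w hw hwl
      have hzw : z.submodule ⊔ w.submodule = x.submodule ⊔ y.submodule :=
        sup_eq_of_mem_points hz (by rw [hxy2, z.finrank_submodule]) hwl (hdisj w hw)
      rw [← hzw, ← sup_assoc, sup_eq_left.mpr hzU]
    refine hxy (eq_of_sup_eq_of_ncard_eq (r := r) hUH (by omega) hBH hBU hB
      (fun Y h1 h2 => hblock Y h1 (by omega)) hx hy ?_)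
    rw [hjoin x hx le_sup_left, hjoin y hy le_sup_right]
  let P : Projectivization.Subspace F V :=
    { carrier := B
      mem_add' := by
        intro v w hv hw hvw h1 h2
        refine hline _ h1 _ h2 _ ?_
        rw [Projectivization.submodule_mk, Projectivization.submodule_mk,
          Projectivization.submodule_mk, Submodule.span_singleton_le_iff_mem]
        exact Submodule.add_mem_sup (Submodule.mem_span_singleton_self v)
          (Submodule.mem_span_singleton_self w) }
  have hBP : B = points (Projectivization.Subspace.submodule P) := by
    ext x
    induction x using Projectivization.ind with
    | h v hv =>
      rw [mem_points, Projectivization.submodule_mk, Submodule.span_singleton_le_iff_mem,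
        Projectivization.Subspace.mem_submodule_iff P hv]
      rfl
  refine ⟨Projectivization.Subspace.submodule P, ?_, ?_, hBP⟩
  · intro v hv
    rcases eq_or_ne v 0 with rfl | hv0
    · exact H.zero_mem
    · have := hBH ((Projectivization.Subspace.mem_submodule_iff P hv0).mp hv)
      rwa [mem_points, Projectivization.submodule_mk, Submodule.span_singleton_le_iff_mem] at this
  · refine hmono.injective ?_
    simp only [← hB, ← ncard_points, ← hBP]

theorem exists_hyperplane_not_le {X : Submodule F V} {r : ℕ}
    (hX : finrank F X + (r + 2) = finrank F V) (H : Submodule F V)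
    {x : Projectivization F V} (hx : x ∉ points X) :
    ∃ W ∈ hyperplanesOver X, W ≠ H ∧ x ∉ points W := by
  have := finite_submodule (F := F) (V := V)
  by_contra! hcon
  have hsub : hyperplanesOver X ⊆ insert H (hyperplanesOver (X ⊔ x.submodule)) := by
    intro W hW
    by_cases hWH : W = H
    · exact Or.inl hWH
    · exact Or.inr ⟨sup_le hW.1 (hcon W hW hWH), hW.2⟩
  have h1 := (Set.ncard_le_ncard hsub (Set.toFinite _)).trans (Set.ncard_insert_le _ _)
  rw [ncard_hyperplanesOver hX, ncard_hyperplanesOver (r := r + 1)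
    (by rw [finrank_sup_submodule hx]; omega), Finset.sum_range_succ _ (r + 1)] at h1
  have h2 := Nat.one_lt_pow (show r + 1 ≠ 0 by omega) (Finite.one_lt_card (α := F))
  omega

theorem hyperplaneCount_equations {K : Set (Projectivization F V)} {a b c : ℕ} (hab : a ≠ b)
    (hac : a ≠ c) (hbc : b ≠ c)
    (hK : ∀ W : Submodule F V, finrank F W + 1 = finrank F V →
      (K ∩ points W).ncard = a ∨ (K ∩ points W).ncard = b ∨ (K ∩ points W).ncard = c)
    {X : Submodule F V} {r : ℕ} (hX : finrank F X + (r + 1) = finrank F V) :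
    hyperplaneCount K X a + hyperplaneCount K X b + hyperplaneCount K X c =
        ∑ i ∈ Finset.range (r + 1), Nat.card F ^ i ∧
      a * hyperplaneCount K X a + b * hyperplaneCount K X b + c * hyperplaneCount K X c =
        (K ∩ points X).ncard * ∑ i ∈ Finset.range (r + 1), Nat.card F ^ i +
          (K \ points X).ncard * ∑ i ∈ Finset.range r, Nat.card F ^ i := by
  classical
  have := finite_submodule (F := F) (V := V)
  have : Fintype (Submodule F V) := Fintype.ofFinite _
  let s := (hyperplanesOver X).toFinset
  have hs : ∀ W, W ∈ s ↔ W ∈ hyperplanesOver X := fun W => Set.mem_toFinset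
  have hcount : ∀ m, hyperplaneCount K X m =
      ∑ W ∈ s, if (K ∩ points W).ncard = m then 1 else 0 := by
    intro m
    rw [hyperplaneCount, ← Finset.card_filter, ← Set.ncard_coe_finset]
    congr 1
    ext W
    simp [hs]
  have hone : ∑ W ∈ s, 1 = ∑ i ∈ Finset.range (r + 1), Nat.card F ^ i := by
    rw [← ncard_hyperplanesOver hX, ← Finset.card_eq_sum_ones, Set.ncard_eq_toFinset_card']
  rw [← sum_ncard_inter_hyperplanesOver K hX s hs, ← hone, hcount, hcount, hcount,
    Finset.mul_sum, Finset.mul_sum, Finset.mul_sum, ← Finset.sum_add_distrib,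
    ← Finset.sum_add_distrib, ← Finset.sum_add_distrib, ← Finset.sum_add_distrib]
  constructor <;> refine Finset.sum_congr rfl fun W hW => ?_ <;>
    rcases hK W ((hs W).mp hW).2 with h | h | h <;>
    simp [h, hab, hac, hbc, hab.symm, hac.symm, hbc.symm]

theorem one_le_hyperplaneCount {K : Set (Projectivization F V)} {X W : Submodule F V} {m : ℕ}
    (hW : W ∈ hyperplanesOver X) (hm : (K ∩ points W).ncard = m) :
    1 ≤ hyperplaneCount K X m := by
  have := finite_submodule (F := F) (V := V)
  exact (Set.ncard_pos (Set.toFinite _)).mpr ⟨W, hW, hm⟩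

theorem hyperplaneCount_add_two_le {K : Set (Projectivization F V)} {X H W : Submodule F V} {m : ℕ}
    (hH : H ∈ hyperplanesOver X) (hW : W ∈ hyperplanesOver X) (hWH : W ≠ H)
    (hHm : (K ∩ points H).ncard ≠ m) (hWm : (K ∩ points W).ncard ≠ m) :
    hyperplaneCount K X m + 2 ≤ (hyperplanesOver X).ncard := by
  have := finite_submodule (F := F) (V := V)
  rw [← Set.ncard_pair hWH, hyperplaneCount, ← Set.ncard_union_eq]
  · refine Set.ncard_le_ncard ?_
    rintro U (hU | rfl | rfl)
    exacts [hU.1, hW, hH]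
  · rw [Set.disjoint_left]
    rintro U hU (rfl | rfl)
    exacts [hWm hU.2, hHm hU.2]

namespace ConeType

variable {q d m e a b c : ℕ} {K : Set (Projectivization F V)}

theorem equations (h : ConeType F q d m e a b c K) {X : Submodule F V} {r : ℕ}
    (hX : finrank F X + (r + 1) = finrank F V) :
    hyperplaneCount K X a + hyperplaneCount K X b + hyperplaneCount K X c =
        ∑ i ∈ Finset.range (r + 1), q ^ i ∧
      a * hyperplaneCount K X a + b * hyperplaneCount K X b + c * hyperplaneCount K X c =
        (K ∩ points X).ncard * ∑ i ∈ Finset.range (r + 1), q ^ i +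
          (K \ points X).ncard * ∑ i ∈ Finset.range r, q ^ i := by
  have h1 := h.a_lt_b
  have h2 := h.b_lt_c
  rw [← h.card_eq]
  exact hyperplaneCount_equations h1.ne (h1.trans h2).ne h2.ne h.type hX

theorem dichotomy (h : ConeType F q d m e a b c K) {H S W W' : Submodule F V}
    (hH : finrank F H = e + 3) (hSfin : finrank F S = e + 1) (hS : K ∩ points H = points S)
    (hW : finrank F W = e + 3) (hWH : W ≠ H) (hSW : S ≤ W)
    (hW' : finrank F W' = e + 3) (hSW' : ¬ S ≤ W') :
    (K.ncard = q ^ (e + 1) * m + a ∧ (K ∩ points W).ncard ≠ b ∧ (K ∩ points W').ncard = b) ∨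
      (K.ncard + q ^ (e + 1) = q ^ (e + 1) * m + a ∧ (K ∩ points W).ncard = b ∧
        (K ∩ points W').ncard ≠ b ∧
        ∃ H' : Submodule F V, finrank F H' = e + 3 ∧ (K ∩ points H').ncard = a ∧ ¬ S ≤ H') := by
  have := finite_projectivization (F := F) (V := V)
  have := finite_submodule (F := F) (V := V)
  have hV := h.finrank_eq
  have hq := h.card_eq
  have hab := h.a_lt_b
  have hSH : S ≤ H := points_subset_iff.mp (hS ▸ Set.inter_subset_right)
  have hW'H : W' ≠ H := by
    rintro rfl
    exact hSW' hSH
  have hHa : (K ∩ points H).ncard = a := by rw [hS, ncard_points, hSfin, hq, h.a_eq]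
  obtain ⟨hT, hHT, hWT⟩ := mem_hyperplanesOver_inf hV hH hW hWH
  obtain ⟨hT', hHT', hWT'⟩ := mem_hyperplanesOver_inf hV hH hW' hW'H
  have hKT : (K ∩ points (W ⊓ H)).ncard = a := by
    rw [points_inf, Set.inter_comm (points W), ← Set.inter_assoc, hS, ← points_inf,
      inf_eq_left.mpr hSW, ncard_points, hSfin, hq, h.a_eq]
  have hKT' : (K ∩ points (W' ⊓ H)).ncard = ∑ i ∈ Finset.range e, q ^ i := by
    rw [points_inf, Set.inter_comm (points W'), ← Set.inter_assoc, hS, ← points_inf,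
      ncard_points, hq]
    have := finrank_inf_hyperplane (S := S) (W := W') (by omega) hSW'
    rw [show finrank F ↥(S ⊓ W') = e by omega]
  have hk := Set.ncard_inter_add_ncard_sdiff_eq_ncard K (points (W ⊓ H)) (Set.toFinite _)
  have hk' := Set.ncard_inter_add_ncard_sdiff_eq_ncard K (points (W' ⊓ H)) (Set.toFinite _)
  obtain ⟨h1, h2⟩ := h.equations hT
  obtain ⟨h1', h2'⟩ := h.equations hT'
  have hα := one_le_hyperplaneCount hHT hHa
  have hα' := one_le_hyperplaneCount hHT' hHa
  have ha : a = ∑ i ∈ Finset.range e, q ^ i + q ^ e := by rw [h.a_eq, Finset.sum_range_succ]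
  have hQ : 0 < q ^ e := pow_pos (by have := h.lt_card; omega) e
  have hc : c = q ^ e * q * d + a := by rw [h.c_eq, pow_succ, h.a_eq]
  have hb := h.b_eq
  set A' := ∑ i ∈ Finset.range e, q ^ i with hA'
  rw [hKT] at hk h2
  rw [hKT'] at hk' h2'
  have hx : (K \ points (W' ⊓ H)).ncard = (K \ points (W ⊓ H)).ncard + q ^ e := by omega
  rw [hx] at h2'
  simp only [Finset.sum_range_succ, Finset.sum_range_zero, zero_add, pow_zero, pow_one,
    mul_one] at h1 h2 h1' h2'
  have hcop : IsCoprime (q : ℤ) ((d : ℤ) - 1) := by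
    have := Nat.isCoprime_iff_coprime.mpr h.coprime.symm
    rwa [Nat.cast_sub (by have := h.two_le; omega), Nat.cast_one] at this
  have hm := h.m_add
  have hd := h.two_le
  have hdq := h.lt_card
  generalize hα_def : hyperplaneCount K (W ⊓ H) a = α at h1 h2 hα
  generalize hβ_def : hyperplaneCount K (W ⊓ H) b = β at h1 h2
  generalize hγ_def : hyperplaneCount K (W ⊓ H) c = γ at h1 h2
  generalize hα'_def : hyperplaneCount K (W' ⊓ H) a = α' at h1' h2' hα'
  generalize hβ'_def : hyperplaneCount K (W' ⊓ H) b = β' at h1' h2'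
  generalize hγ'_def : hyperplaneCount K (W' ⊓ H) c = γ' at h1' h2'
  rw [hb, hc, add_comm 1 q] at h2 h2'
  rw [add_comm 1 q] at h1 h1'
  have hmain := pencil_arithmetic_s19 (q := q) (d := d) (m := m) (Q := (q ^ e : ℕ)) (A := a)
    (A' := A') (x := (K \ points (W ⊓ H)).ncard) (α := α) (β := β) (γ := γ)
    (α' := α') (β' := β') (γ' := γ') (by exact_mod_cast hd) (by exact_mod_cast hdq)
    hcop (by exact_mod_cast hm) (by exact_mod_cast hQ) (by exact_mod_cast ha)
    (by exact_mod_cast hα) (by positivity) (by positivity)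
    (by exact_mod_cast hα') (by positivity) (by positivity)
    (by exact_mod_cast h1) (by exact_mod_cast h1')
    (by exact_mod_cast h2) (by exact_mod_cast h2')
  have hpencil : ∀ U : Submodule F V, finrank F ↥(U ⊓ H) + (1 + 1) = finrank F V →
      (hyperplanesOver (U ⊓ H)).ncard = q + 1 := by
    intro U hU
    rw [ncard_hyperplanesOver hU, hq]
    simp [Finset.sum_range_succ, add_comm]
  have hHb : (K ∩ points H).ncard ≠ b := by omega
  rcases hmain with ⟨hβ, hβ', hx1⟩ | ⟨hβ, hβ', hx1, hα2⟩
  · left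
    refine ⟨?_, ?_, ?_⟩
    · rw [← hk, pow_succ, add_comm]
      congr 1
      exact_mod_cast hx1
    · intro hWb
      have := one_le_hyperplaneCount hWT hWb
      omega
    · by_contra hWb
      have := hyperplaneCount_add_two_le hHT' hWT' hW'H hHb hWb
      rw [hpencil _ hT'] at this
      omega
  · right
    refine ⟨?_, ?_, ?_, ?_⟩
    · rw [← hk, pow_succ, add_assoc, add_comm]
      congr 1
      exact_mod_cast hx1
    · by_contra hWb
      have := hyperplaneCount_add_two_le hHT hWT hWH hHb hWb
      rw [hpencil _ hT] at this
      omega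
    · intro hWb
      have := one_le_hyperplaneCount hWT' hWb
      omega
    · obtain ⟨H', ⟨hH'T, hH'a⟩, hH'H⟩ := Set.exists_ne_of_one_lt_ncard
        (show 1 < hyperplaneCount K (W' ⊓ H) a by omega) H
      have hH' : finrank F H' = e + 3 := by
        have := hH'T.2
        omega
      refine ⟨H', hH', hH'a, fun hSH' => hSW' ?_⟩
      have h3 := (mem_hyperplanesOver_inf hV hH hH' hH'H).1
      have h4 : W' ⊓ H = H' ⊓ H :=
        Submodule.eq_of_le_of_finrank_le (le_inf hH'T.1 inf_le_right) (by omega)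
      exact (h4 ▸ le_inf hSH' hSH : S ≤ W' ⊓ H).trans inf_le_left

theorem exists_vertex (h : ConeType F q d m e a b c K)
    (hblock : ∀ Y : Submodule F V, finrank F Y = 3 → (K ∩ points Y).Nonempty)
    {H : Submodule F V} (hH : finrank F H = e + 3) (hHa : (K ∩ points H).ncard = a) :
    ∃ S : Submodule F V, finrank F S = e + 1 ∧ K ∩ points H = points S := by
  obtain ⟨S, -, hS, hKS⟩ := exists_eq_points_of_blocking (B := K ∩ points H) (r := e + 1) hH
    Set.inter_subset_right (by rw [hHa, h.a_eq, h.card_eq]) fun Y hYH hY => by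
      rw [Set.inter_assoc, Set.inter_eq_right.mpr (points_mono hYH)]
      exact hblock Y hY
  exact ⟨S, hS, hKS⟩

theorem exists_hyperplane_not_ge (h : ConeType F q d m e a b c K) {S : Submodule F V}
    (hS : finrank F S = e + 1) :
    ∃ W : Submodule F V, finrank F W = e + 3 ∧ ¬ S ≤ W := by
  have := finite_projectivization (F := F) (V := V)
  have hne : (points S).Nonempty := by
    rw [← Set.ncard_pos (Set.toFinite _), ncard_points, hS, Finset.sum_range_succ']
    simp
  obtain ⟨x, hx⟩ := hne
  have hbot : x ∉ points (⊥ : Submodule F V) := by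
    intro hx0
    have h1 := x.finrank_submodule
    rw [le_bot_iff.mp (mem_points.mp hx0), finrank_bot] at h1
    omega
  obtain ⟨W, hW, -, hxW⟩ := exists_hyperplane_not_le (X := (⊥ : Submodule F V)) (r := e + 2)
    (by rw [finrank_bot, h.finrank_eq]; omega) ⊥ hbot
  have hV := h.finrank_eq
  exact ⟨W, by have := hW.2; omega, fun hSW => hxW (points_mono hSW hx)⟩

theorem exists_hyperplane_ge (h : ConeType F q d m e a b c K) {S S' : Submodule F V}
    (H : Submodule F V) (hS : finrank F S = e + 1) (hS' : ¬ S' ≤ S) :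
    ∃ W : Submodule F V, finrank F W = e + 3 ∧ W ≠ H ∧ S ≤ W ∧ ¬ S' ≤ W := by
  rw [← points_subset_iff] at hS'
  obtain ⟨x, hxS', hxS⟩ := Set.not_subset.mp hS'
  obtain ⟨W, hW, hWH, hxW⟩ := exists_hyperplane_not_le (r := 1)
    (by rw [hS, h.finrank_eq]) H hxS
  have hV := h.finrank_eq
  exact ⟨W, by have := hW.2; omega, hWH, hW.1, fun hSW => hxW (points_mono hSW hxS')⟩

theorem ncard_eq_and_inter_eq_iff (h : ConeType F q d m e a b c K)
    (hblock : ∀ Y : Submodule F V, finrank F Y = 3 → (K ∩ points Y).Nonempty)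
    {H S : Submodule F V} (hH : finrank F H = e + 3) (hS : finrank F S = e + 1)
    (hKS : K ∩ points H = points S) :
    K.ncard = q ^ (e + 1) * m + a ∧
      ∀ W : Submodule F V, finrank F W = e + 3 → ((K ∩ points W).ncard = b ↔ ¬ S ≤ W) := by
  have hQ : 0 < q ^ (e + 1) := pow_pos (by have := h.lt_card; omega) _
  have hHa : (K ∩ points H).ncard = a := by rw [hKS, ncard_points, hS, h.card_eq, h.a_eq]
  have hab := h.a_lt_b
  obtain ⟨W₁, hW₁, hW₁H, hSW₁, -⟩ := h.exists_hyperplane_ge H hS (h.not_top_le hS)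
  obtain ⟨W₂, hW₂, hSW₂⟩ := h.exists_hyperplane_not_ge hS
  rcases h.dichotomy hH hS hKS hW₁ hW₁H hSW₁ hW₂ hSW₂ with ⟨hk, hb₁, hb₂⟩ |
    ⟨hk, -, -, H', hH', hH'a, hSH'⟩
  · refine ⟨hk, fun W hW => ⟨fun hWb hSW => ?_, fun hSW => ?_⟩⟩
    · have hWH : W ≠ H := by
        rintro rfl
        omega
      rcases h.dichotomy hH hS hKS hW hWH hSW hW₂ hSW₂ with h1 | h1
      · exact h1.2.1 hWb
      · omega
    · rcases h.dichotomy hH hS hKS hW₁ hW₁H hSW₁ hW hSW with h1 | h1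
      · exact h1.2.2
      · omega
  · exfalso
    obtain ⟨S', hS', hKS'⟩ := h.exists_vertex hblock hH' hH'a
    have hSS' : ¬ S' ≤ S := fun hle => by
      rw [← Submodule.eq_of_le_of_finrank_le hle (by omega)] at hSH'
      exact hSH' (points_subset_iff.mp (hKS' ▸ Set.inter_subset_right))
    obtain ⟨W, hW, hWH, hSW, hS'W⟩ := h.exists_hyperplane_ge H hS hSS'
    obtain ⟨W₃, hW₃, hW₃H, hSW₃, -⟩ := h.exists_hyperplane_ge H' hS' (h.not_top_le hS')
    rcases h.dichotomy hH hS hKS hW hWH hSW hW₂ hSW₂ with h1 | h1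
    · omega
    · rcases h.dichotomy hH' hS' hKS' hW₃ hW₃H hSW₃ hW hS'W with h2 | h2
      · omega
      · exact h2.2.2.1 h1.2.1

theorem counts (h : ConeType F q d m e a b c K)
    (hblock : ∀ Y : Submodule F V, finrank F Y = 3 → (K ∩ points Y).Nonempty)
    (ha : ∃ H : Submodule F V, finrank F H = e + 3 ∧ (K ∩ points H).ncard = a) :
    K.ncard = q ^ (e + 1) * m + a ∧
      d * hyperplaneCount K ⊥ a = q * (q + 1 - d) ∧
      hyperplaneCount K ⊥ b =
        ∑ i ∈ Finset.range (e + 4), q ^ i - ∑ i ∈ Finset.range 3, q ^ i ∧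
      d * hyperplaneCount K ⊥ c = (q + 1) * m := by
  have := finite_projectivization (F := F) (V := V)
  have := finite_submodule (F := F) (V := V)
  obtain ⟨H, hH, hHa⟩ := ha
  obtain ⟨S, hS, hKS⟩ := h.exists_vertex hblock hH hHa
  obtain ⟨hk, hiff⟩ := h.ncard_eq_and_inter_eq_iff hblock hH hS hKS
  have hV := h.finrank_eq
  have hab := h.a_lt_b
  have hbc := h.b_lt_c
  have hSV : finrank F S + (2 + 1) = finrank F V := by omega
  have hbiff : ∀ {X W : Submodule F V}, W ∈ hyperplanesOver X →
      ((K ∩ points W).ncard = b ↔ ¬ S ≤ W) := fun {X W} hW => hiff W (by have := hW.2; omega)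
  have hne : ∀ l, l ≠ b → hyperplaneCount K ⊥ l = hyperplaneCount K S l := by
    refine fun l hl => hyperplaneCount_bot_eq K fun W hW hWl => ?_
    by_contra hSW
    exact hl (hWl.symm.trans ((hbiff hW).mpr hSW))
  have hSb : hyperplaneCount K S b = 0 := by
    rw [hyperplaneCount, Set.ncard_eq_zero (Set.toFinite _)]
    exact Set.eq_empty_of_forall_notMem fun W hW => (hbiff hW.1).mp hW.2 hW.1.1
  have hSH : S ≤ H := points_subset_iff.mp (hKS ▸ Set.inter_subset_right)
  have hSK : points S ⊆ K := hKS ▸ Set.inter_subset_left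
  have hKSa : (K ∩ points S).ncard = a := by rw [Set.inter_eq_right.mpr hSK, ← hKS, hHa]
  have hdiff := Set.ncard_inter_add_ncard_sdiff_eq_ncard K (points S) (Set.toFinite _)
  obtain ⟨h1, h2⟩ := h.equations hSV
  rw [hKSa, hk] at hdiff
  rw [hKSa, show (K \ points S).ncard = q ^ (e + 1) * m by omega, hSb] at h2
  rw [hSb] at h1
  simp only [Finset.sum_range_succ, Finset.sum_range_zero, zero_add, pow_zero, pow_one,
    add_zero, mul_zero] at h1 h2
  have hc : c = q ^ (e + 1) * d + a := by rw [h.c_eq, h.a_eq]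
  have hQ : 0 < q ^ (e + 1) := pow_pos (by have := h.lt_card; omega) _
  have htc : d * hyperplaneCount K S c = (q + 1) * m := by
    refine Nat.eq_of_mul_eq_mul_left hQ ?_
    have h3 : a * (hyperplaneCount K S a + hyperplaneCount K S c) +
        q ^ (e + 1) * (d * hyperplaneCount K S c) =
        a * (1 + q + q ^ 2) + q ^ (e + 1) * ((q + 1) * m) := by
      have : a * hyperplaneCount K S a + (q ^ (e + 1) * d + a) * hyperplaneCount K S c =
          a * (1 + q + q ^ 2) + q ^ (e + 1) * m * (1 + q) := hc ▸ h2
      linarith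
    rw [h1] at h3
    omega
  refine ⟨hk, ?_, ?_, ?_⟩
  · rw [hne a hab.ne]
    have hm := h.m_add
    have hdq := h.lt_card
    zify [show d ≤ q + 1 by omega] at h1 htc hm ⊢
    linear_combination (d : ℤ) * h1 - htc - (q + 1) * hm
  · rw [← h.card_eq, ← ncard_hyperplanesOver (X := (⊥ : Submodule F V)) (by simp [hV]),
      ← ncard_hyperplanesOver hSV,
      ← Set.ncard_sdiff (show hyperplanesOver S ⊆ hyperplanesOver ⊥ from
        fun W hW => ⟨bot_le, hW.2⟩)]
    refine congrArg Set.ncard (Set.ext fun W => ?_)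
    constructor
    · rintro ⟨hW, hWb⟩
      exact ⟨hW, fun hSW => (hbiff hW).mp hWb hSW.1⟩
    · rintro ⟨hW, hWS⟩
      exact ⟨hW, (hbiff hW).mpr fun hSW => hWS ⟨hSW, hW.2⟩⟩
  · rw [hne c hbc.ne', htc]

end ConeType

end Counting

/-- In `PG(n,q)`, `n ≥ 5`, with `2 ≤ d ≤ q-1` and `gcd(d-1, q) = 1`,
if `K` is a plane blocking set of type
`(θ_{n-3}, q^{n-3}(qd+d-q) + θ_{n-4}, q^{n-2}d + θ_{n-3})_{n-1}`, then
`k = q^{n-2}(qd+d-q) + θ_{n-3}`, `t_a = q(q+1-d)/d`, `t_b = θ_n - θ_2` and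
`t_c = (q+1)(qd+d-q)/d`. -/
theorem statement19 [Fintype F] (q n d : ℕ) (hq : Fintype.card F = q) (hn : 5 ≤ n)
    (hd2 : 2 ≤ d) (hdq : d ≤ q - 1) (hgcd : Nat.gcd (d - 1) q = 1)
    (K : Set (PGPoint F n)) (hblock : BlocksDim F n 2 K)
    (hK : IsType3 F n K (theta q (n - 3)) (q ^ (n - 3) * (q * d + d - q) + theta q (n - 4))
      (q ^ (n - 2) * d + theta q (n - 3))) :
    K.ncard = q ^ (n - 2) * (q * d + d - q) + theta q (n - 3) ∧
    tnum F n K (theta q (n - 3)) = q * (q + 1 - d) / d ∧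
    tnum F n K (q ^ (n - 3) * (q * d + d - q) + theta q (n - 4)) = theta q n - theta q 2 ∧
    tnum F n K (q ^ (n - 2) * d + theta q (n - 3)) = (q + 1) * (q * d + d - q) / d := by
  have hq2 : 2 ≤ q := by omega
  obtain ⟨e, rfl⟩ : ∃ e, n = e + 3 := ⟨n - 3, by omega⟩
  obtain ⟨e, rfl⟩ : ∃ e', e = e' + 1 := ⟨e - 1, by omega⟩
  have htheta : ∀ j, theta q j = ∑ i ∈ Finset.range (j + 1), q ^ i :=
    fun j => (Nat.geomSum_eq hq2 (j + 1)).symm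
  have hm : q * d + d - q + q = q * d + d := Nat.sub_add_cancel (by nlinarith)
  simp only [htheta, show e + 1 + 3 - 3 = e + 1 by omega, show e + 1 + 3 - 4 = e by omega,
    show e + 1 + 3 - 2 = e + 1 + 1 by omega] at hK ⊢
  generalize q * d + d - q = m at hm hK ⊢
  have hV : finrank F (Fin (e + 1 + 3 + 1) → F) = e + 1 + 4 := Module.finrank_fin_fun F
  have hcone : ConeType F q d m (e + 1) _ _ _ K :=
    { finrank_eq := hV
      card_eq := by rw [Nat.card_eq_fintype_card, hq]
      two_le := hd2
      lt_card := by omega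
      coprime := hgcd
      m_add := hm
      a_eq := rfl
      b_eq := rfl
      c_eq := rfl
      type := fun W hW => hK.1 W (by omega) }
  obtain ⟨hk, ha, hb, hc⟩ := hcone.counts hblock hK.2.1
  have htnum : ∀ l, tnum F (e + 1 + 3) K l = hyperplaneCount K ⊥ l := by
    intro l
    refine congrArg Set.ncard (Set.ext fun W => and_congr_left fun _ => ?_)
    exact ⟨fun hW => ⟨bot_le, by omega⟩, fun hW => by have := hW.2; omega⟩
  have hd : 0 < d := by omega
  rw [htnum, htnum, htnum]
  exact ⟨hk, (Nat.div_eq_of_eq_mul_right hd ha.symm).symm, hb,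
    (Nat.div_eq_of_eq_mul_right hd hc.symm).symm⟩
end
end
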